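/- Let (W,S) be the affine Coxeter system of type D̃_4: S = {0,1,2,3,4} with m(0,2) = m(1,2) = m(2,3) = m(2,4) = 3 and all other pairs commuting (m = 2). Then the homology of the weighted complex C_*(W) is: H_0 ≅ R/(Φ_2); H_1 ≅ R/(Φ_3); H_2 ≅ (R/(Φ_4))³; H_3 ≅ (R/(Φ_2))⁴ ⊕ (R/(Φ_4))³ ⊕ (R/(Φ_6))³; H_4 ≅ R; and H_k = 0 for all k ≥ 5. -/

import Mathlib

open Polynomial CoxeterSystem

set_option synthInstance.maxHeartbeats 1000000
set_option maxHeartbeats 1000000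

noncomputable section

/-- The ring `R = ℚ[q,q⁻¹]` of Laurent polynomials over `ℚ`. -/
abbrev R : Type := LaurentPolynomial ℚ

/-- The image of the `d`-th cyclotomic polynomial `Φ_d` in `R`. -/
def cyc (d : ℕ) : R := Polynomial.toLaurent (Polynomial.cyclotomic d ℚ)

/-- The `R`-module `R/(Φ_d)`. -/
abbrev CycQuot (d : ℕ) := R ⧸ Ideal.span {cyc d}

variable {B : Type*} [Fintype B] [LinearOrder B] {W : Type*} [Group W]
  {M : CoxeterMatrix B} (cs : CoxeterSystem M W)

/-- The standard parabolic subgroup `W_σ` generated by `σ ⊆ S`. -/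
def parabolic (σ : Finset B) : Subgroup W := Subgroup.closure (cs.simple '' σ)

/-- The Poincaré polynomial `W_σ(q) = Σ_{w ∈ W_σ} q^{ℓ(w)}` of the standard parabolic
subgroup `W_σ` (defined to be `0` if `W_σ` is infinite). -/
def poin (σ : Finset B) : ℚ[X] :=
  letI := Classical.dec ((parabolic cs σ : Set W).Finite)
  if h : (parabolic cs σ : Set W).Finite then ∑ w ∈ h.toFinset, X ^ cs.length w else 0

/-- The set of simplices `σ ∈ K_W` with `|σ| = k`, i.e. the subsets of `S` of
cardinality `k` generating a finite standard parabolic subgroup. -/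
abbrev KW (k : ℕ) := {σ : Finset B // σ.card = k ∧ (parabolic cs σ : Set W).Finite}

noncomputable instance (k : ℕ) : Fintype (KW cs k) := Fintype.ofFinite _

/-- The coefficient of `e_τ` in `∂ e_σ`: it is
`(−1)^{#{t ∈ σ : t < s}} · W_σ(q)/W_{σ∖{s}}(q)` if `τ = σ ∖ {s}` for some `s ∈ σ`,
and `0` otherwise. -/
def bcoeff (σ τ : Finset B) : R :=
  ∑ s ∈ σ, if τ = σ.erase s then
      (-1 : R) ^ (σ.filter (fun t => t < s)).card *
        Polynomial.toLaurent (poin cs σ / poin cs τ)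
    else 0

/-- The boundary map `∂ : C_{k+1} → C_k` of the weighted complex `C_*(W)`, where
`C_k = ⊕_{σ ∈ K_W, |σ| = k} R·e_σ`. -/
def bdry (k : ℕ) : (KW cs (k + 1) → R) →ₗ[R] (KW cs k → R) :=
  Matrix.mulVecLin (Matrix.of fun (τ : KW cs k) (σ : KW cs (k + 1)) => bcoeff cs σ.1 τ.1)

/-- The submodule of cycles in degree `k` of the weighted complex. -/
def cycles : (k : ℕ) → Submodule R (KW cs k → R)
  | 0 => ⊤
  | (k + 1) => LinearMap.ker (bdry cs k)

/-- The `k`-th homology `H_k(C_*(W))` of the weighted complex: cycles modulo boundaries. -/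
abbrev Hgy (k : ℕ) :=
  cycles cs k ⧸ Submodule.comap (cycles cs k).subtype (LinearMap.range (bdry cs k))

end

/-! ### Coset tables for the Weyl group of type `D₄`

The generators of `D₄` are labelled by `Fin 4`, with `0` the central node. The Weyl group is
modelled by the set `D4Model`, obtained from the chain of parabolic subgroups
`1 ⊂ A₁ ⊂ A₂ ⊂ A₃ ⊂ D₄` and the minimal coset representatives of each step. -/

/-- A set in bijection with the Weyl group of type `D₄`. -/
abbrev D4Model : Type := Fin 2 × Fin 3 × Fin 4 × Fin 8

/-- Right multiplication of the minimal representatives of `A₁ \ A₂` by generators. The value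
`inr r'` means `r s = r'`, and `inl s'` means `r s = s' r`. -/
def cosetTableA2 : Fin 3 → Fin 4 → Fin 4 ⊕ Fin 3
  | 0, 1 => .inr 1
  | 1, 0 => .inr 2
  | 1, 1 => .inr 0
  | 2, 0 => .inr 1
  | _, _ => .inl 0

/-- Right multiplication of the minimal representatives of `A₂ \ A₃` by generators. -/
def cosetTableA3 : Fin 4 → Fin 4 → Fin 4 ⊕ Fin 4
  | 0, 0 => .inl 0
  | 0, 1 => .inl 1
  | 0, 2 => .inr 1
  | 1, 0 => .inr 2
  | 1, 1 => .inl 1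
  | 1, 2 => .inr 0
  | 2, 0 => .inr 1
  | 2, 1 => .inr 3
  | 3, 0 => .inl 1
  | 3, 1 => .inr 2
  | _, _ => .inl 0

/-- Right multiplication of the minimal representatives of `A₃ \ D₄` by generators. -/
def cosetTableD4 : Fin 8 → Fin 4 → Fin 4 ⊕ Fin 8
  | 0, 0 => .inl 0
  | 0, 1 => .inl 1
  | 0, 2 => .inl 2
  | 0, 3 => .inr 1
  | 1, 0 => .inr 2
  | 1, 1 => .inl 1
  | 1, 2 => .inl 2
  | 1, 3 => .inr 0
  | 2, 0 => .inr 1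
  | 2, 1 => .inr 3
  | 2, 2 => .inr 4
  | 3, 0 => .inl 1
  | 3, 1 => .inr 2
  | 3, 2 => .inr 5
  | 4, 0 => .inl 2
  | 4, 1 => .inr 5
  | 4, 2 => .inr 2
  | 5, 0 => .inr 6
  | 5, 1 => .inr 4
  | 5, 2 => .inr 3
  | 6, 0 => .inr 5
  | 6, 1 => .inl 2
  | 6, 2 => .inl 1
  | 6, 3 => .inr 7
  | 7, 1 => .inl 2
  | 7, 2 => .inl 1
  | 7, 3 => .inr 6
  | _, _ => .inl 0

/-- Reduced words of the elements of `A₁`. -/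
def wordA1 : Fin 2 → List (Fin 4)
  | 0 => []
  | 1 => [0]

/-- Reduced words of the minimal representatives of `A₁ \ A₂`. -/
def wordA2 : Fin 3 → List (Fin 4)
  | 0 => []
  | 1 => [1]
  | 2 => [1, 0]

/-- Reduced words of the minimal representatives of `A₂ \ A₃`. -/
def wordA3 : Fin 4 → List (Fin 4)
  | 0 => []
  | 1 => [2]
  | 2 => [2, 0]
  | 3 => [2, 0, 1]

/-- Reduced words of the minimal representatives of `A₃ \ D₄`. -/
def wordD4 : Fin 8 → List (Fin 4)
  | 0 => []
  | 1 => [3]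
  | 2 => [3, 0]
  | 3 => [3, 0, 1]
  | 4 => [3, 0, 2]
  | 5 => [3, 0, 1, 2]
  | 6 => [3, 0, 1, 2, 0]
  | 7 => [3, 0, 1, 2, 0, 3]

namespace D4Model

/-- A reduced word of an element of the model. -/
def word (x : D4Model) : List (Fin 4) :=
  wordA1 x.1 ++ (wordA2 x.2.1 ++ (wordA3 x.2.2.1 ++ wordD4 x.2.2.2))

/-- Right multiplication by a generator on the elements of `A₁`. -/
def actA1 (x : Fin 2) : Fin 2 := x + 1

/-- Right multiplication by a generator on the elements of `A₂`. -/
def actA2 (s : Fin 4) (x : Fin 2 × Fin 3) : Fin 2 × Fin 3 :=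
  match cosetTableA2 x.2 s with
  | .inl _ => (actA1 x.1, x.2)
  | .inr r => (x.1, r)

/-- Right multiplication by a generator on the elements of `A₃`. -/
def actA3 (s : Fin 4) (x : Fin 2 × Fin 3 × Fin 4) : Fin 2 × Fin 3 × Fin 4 :=
  match cosetTableA3 x.2.2 s with
  | .inl t => ((actA2 t (x.1, x.2.1)).1, (actA2 t (x.1, x.2.1)).2, x.2.2)
  | .inr r => (x.1, x.2.1, r)

/-- Right multiplication by a generator on the elements of `D₄`. -/
def act (s : Fin 4) (x : D4Model) : D4Model :=
  match cosetTableD4 x.2.2.2 s with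
  | .inl t => ((actA3 t (x.1, x.2.1, x.2.2.1)).1, (actA3 t (x.1, x.2.1, x.2.2.1)).2.1,
      (actA3 t (x.1, x.2.1, x.2.2.1)).2.2, x.2.2.2)
  | .inr r => (x.1, x.2.1, x.2.2.1, r)

theorem act_act : ∀ (s : Fin 4) (x : D4Model), act s (act s x) = x := by
  decide +kernel

theorem act_braid : ∀ (s : Fin 4), s ≠ 0 → ∀ (x : D4Model),
    act s (act 0 (act s x)) = act 0 (act s (act 0 x)) := by
  decide +kernel

theorem act_comm : ∀ (s t : Fin 4), s ≠ 0 → t ≠ 0 → ∀ (x : D4Model),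
    act s (act t x) = act t (act s x) := by
  decide +kernel

theorem length_word_act_le : ∀ (s : Fin 4) (x : D4Model),
    (act s x).word.length ≤ x.word.length + 1 := by
  decide +kernel

theorem foldl_act_word : ∀ x : D4Model, x.word.foldl (fun y s => act s y) 0 = x := by
  decide +kernel

/-- The elements of the model lying in the parabolic subgroup generated by the labels `< m`. -/
def below (m : ℕ) : Finset D4Model :=
  (Finset.univ.filter fun r => 0 < m ∨ r = 0) ×ˢ ((Finset.univ.filter fun r => 1 < m ∨ r = 0) ×ˢ
    ((Finset.univ.filter fun r => 2 < m ∨ r = 0) ×ˢ (Finset.univ.filter fun r => 3 < m ∨ r = 0)))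

theorem act_mem_below : ∀ m : Fin 5, ∀ s : Fin 4, s.val < m.val → ∀ x ∈ below m,
    act s x ∈ below m := by
  decide +kernel

theorem lt_of_mem_word : ∀ m : Fin 5, ∀ x ∈ below m, ∀ s ∈ x.word, s.val < m.val := by
  decide +kernel

theorem sum_below (m : ℕ) : ∑ x ∈ below m, (X : ℚ[X]) ^ x.word.length =
    (∑ r with 0 < m ∨ r = 0, (X : ℚ[X]) ^ (wordA1 r).length) *
    ((∑ r with 1 < m ∨ r = 0, (X : ℚ[X]) ^ (wordA2 r).length) *
    ((∑ r with 2 < m ∨ r = 0, (X : ℚ[X]) ^ (wordA3 r).length) *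
    (∑ r with 3 < m ∨ r = 0, (X : ℚ[X]) ^ (wordD4 r).length))) := by
  simp only [below, Finset.sum_product, word, List.length_append, pow_add, ← Finset.mul_sum,
    ← Finset.sum_mul]

section Group

variable {G : Type*} [Group G]

theorem prod_word_act (v : Fin 4 → G) (hv : ∀ s, v s * v s = 1)
    (hbraid : ∀ s, s ≠ 0 → v 0 * v s * v 0 = v s * v 0 * v s)
    (hcomm : ∀ s t, s ≠ 0 → t ≠ 0 → v s * v t = v t * v s) (s : Fin 4) (x : D4Model) :
    ((act s x).word.map v).prod = (x.word.map v).prod * v s := by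
  have hz := hv 0
  have ha := hv 1
  have hb := hv 2
  have hc := hv 3
  have za := hbraid 1 (by decide)
  have zb := hbraid 2 (by decide)
  have zc := hbraid 3 (by decide)
  have ab := hcomm 1 2 (by decide) (by decide)
  have ac := hcomm 1 3 (by decide) (by decide)
  have bc := hcomm 2 3 (by decide) (by decide)
  let p (l : List (Fin 4)) : G := (l.map v).prod
  have key1 : ∀ r, p (wordA1 (actA1 r)) = p (wordA1 r) * v 0 := by
    intro r
    fin_cases r <;> simp [p, wordA1, actA1, hz]
  have key2 : ∀ r s, s.val < 2 → match cosetTableA2 r s with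
      | .inl _ => p (wordA2 r) * v s = v 0 * p (wordA2 r)
      | .inr r' => p (wordA2 r) * v s = p (wordA2 r') := by
    intro r s hs
    fin_cases r <;> fin_cases s <;> simp [p, wordA2, cosetTableA2] at hs ⊢ <;> grind
  have key3 : ∀ r s, s.val < 3 → match cosetTableA3 r s with
      | .inl t => t.val < 2 ∧ p (wordA3 r) * v s = v t * p (wordA3 r)
      | .inr r' => p (wordA3 r) * v s = p (wordA3 r') := by
    intro r s hs
    fin_cases r <;> fin_cases s <;> simp [p, wordA3, cosetTableA3] at hs ⊢ <;> grind
  have key4 : ∀ r s, match cosetTableD4 r s with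
      | .inl t => t.val < 3 ∧ p (wordD4 r) * v s = v t * p (wordD4 r)
      | .inr r' => p (wordD4 r) * v s = p (wordD4 r') := by
    intro r s
    fin_cases r <;> fin_cases s <;> simp [p, wordD4, cosetTableD4] <;> grind
  have act2 : ∀ s, s.val < 2 → ∀ x, p (wordA1 (actA2 s x).1) * p (wordA2 (actA2 s x).2) =
      p (wordA1 x.1) * p (wordA2 x.2) * v s := by
    intro s hs x
    have h := key2 x.2 s hs
    unfold actA2
    split at h <;> simp only [key1, mul_assoc, h]
  have act3 : ∀ s, s.val < 3 → ∀ x, p (wordA1 (actA3 s x).1) *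
      (p (wordA2 (actA3 s x).2.1) * p (wordA3 (actA3 s x).2.2)) =
      p (wordA1 x.1) * (p (wordA2 x.2.1) * p (wordA3 x.2.2)) * v s := by
    intro s hs x
    have h := key3 x.2.2 s hs
    unfold actA3
    split at h
    · simp only [mul_assoc, h.2]
      rw [← mul_assoc, act2 _ h.1]
      simp only [mul_assoc]
    · simp only [mul_assoc, h]
  have h := key4 x.2.2.2 s
  change p (act s x).word = p x.word * v s
  have hw : ∀ y : D4Model, p y.word =
      p (wordA1 y.1) * (p (wordA2 y.2.1) * p (wordA3 y.2.2.1)) * p (wordD4 y.2.2.2) := by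
    intro y
    simp [p, word, mul_assoc]
  rw [hw, hw]
  unfold act
  split at h
  · simp only
    rw [act3 _ h.1]
    simp only [mul_assoc, h.2]
  · simp only [mul_assoc, h]

end Group

end D4Model

/-! ### Poincaré polynomials of parabolic subgroups -/

section Poincare

variable {B : Type*} {W : Type*} [Group W] {M : CoxeterMatrix B} (cs : CoxeterSystem M W)

theorem simple_mem_parabolic {σ : Finset B} {s : B} (hs : s ∈ σ) :
    cs.simple s ∈ parabolic cs σ :=
  Subgroup.subset_closure ⟨s, hs, rfl⟩

/-- The Poincaré polynomial of a parabolic subgroup from an explicit enumeration of it which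
is closed under right multiplication by the generators. -/
theorem poin_eq_sum {ι : Type*} {σ : Finset B} (Y : Finset ι) (φ : ι → W) (N : ι → ℕ)
    (hφ : ∀ y ∈ Y, φ y ∈ parabolic cs σ) (hone : ∃ y ∈ Y, φ y = 1)
    (hmul : ∀ y ∈ Y, ∀ s ∈ σ, ∃ y' ∈ Y, φ y' = φ y * cs.simple s)
    (hinj : Set.InjOn φ Y) (hlen : ∀ y ∈ Y, cs.length (φ y) = N y) :
    (parabolic cs σ : Set W).Finite ∧ poin cs σ = ∑ y ∈ Y, X ^ N y := by
  classical
  have hset : (parabolic cs σ : Set W) = φ '' Y := by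
    ext w
    constructor
    · intro hw
      induction hw using Subgroup.closure_induction_right with
      | one => exact hone
      | mul_right x hx y hy ih =>
        obtain ⟨z, hz, rfl⟩ := ih
        obtain ⟨s, hs, rfl⟩ := hy
        exact hmul z hz s hs
      | mul_inv_cancel x hx y hy ih =>
        obtain ⟨z, hz, rfl⟩ := ih
        obtain ⟨s, hs, rfl⟩ := hy
        rw [cs.inv_simple]
        exact hmul z hz s hs
    · rintro ⟨y, hy, rfl⟩
      exact hφ y hy
  have hfin : (parabolic cs σ : Set W).Finite := hset ▸ (Y.finite_toSet.image φ)
  refine ⟨hfin, ?_⟩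
  have him : hfin.toFinset = Y.image φ := by
    ext w
    rw [Set.Finite.mem_toFinset, hset]
    simp
  unfold poin
  rw [dif_pos hfin, him, Finset.sum_image hinj]
  exact Finset.sum_congr rfl fun y hy => by rw [hlen y hy]

end Poincare

section AffineD4

variable {W : Type*} [Group W] {Mat : CoxeterMatrix (Fin 5)}

/-- The Coxeter matrix of type `D̃₄`, with central node `2`. -/
def IsAffineD4 (Mat : CoxeterMatrix (Fin 5)) : Prop :=
  ∀ i j : Fin 5, Mat.M i j = if i = j then 1 else if i = 2 ∨ j = 2 then 3 else 2

theorem isAffineD4_of_lt (hM : ∀ i j : Fin 5, i.val < j.val →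
      Mat.M i j = (if (i.val, j.val) ∈ ([(0, 2), (1, 2), (2, 3), (2, 4)] : List (ℕ × ℕ))
        then 3 else 2)) : IsAffineD4 Mat := by
  intro i j
  rcases lt_trichotomy i j with h | rfl | h
  · rw [hM i j h]
    revert i j
    decide
  · simp
  · have hs : Mat.M i j = Mat.M j i := Mat.symmetric i j
    rw [hs, hM j i h]
    clear hs
    revert i j
    decide

theorem isLiftable_of_relations (hM : IsAffineD4 Mat) {G : Type*} [Monoid G] (f : Fin 5 → G)
    (hsq : ∀ i, f i * f i = 1)
    (hbraid : ∀ i, i ≠ 2 → f i * f 2 * f i = f 2 * f i * f 2)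
    (hcomm : ∀ i j, i ≠ 2 → j ≠ 2 → f i * f j = f j * f i) : Mat.IsLiftable f := by
  have h2 : ∀ i x, f i * (f i * x) = x := fun i x => by rw [← mul_assoc, hsq, one_mul]
  intro i j
  rw [show Mat i j = _ from hM i j]
  split_ifs with h1 h3
  · subst h1
    rw [pow_one, hsq]
  · rcases h3 with rfl | rfl
    · have h := hbraid j (Ne.symm h1)
      calc (f 2 * f j) ^ 3 = (f 2 * f j * f 2) * (f j * f 2 * f j) := by
            simp only [pow_succ, pow_zero, one_mul, mul_assoc]
        _ = 1 := by rw [h]; simp only [mul_assoc, h2, hsq]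
    · have h := hbraid i h1
      calc (f i * f 2) ^ 3 = (f i * f 2 * f i) * (f 2 * f i * f 2) := by
            simp only [pow_succ, pow_zero, one_mul, mul_assoc]
        _ = 1 := by rw [h]; simp only [mul_assoc, h2, hsq]
  · push Not at h3
    calc (f i * f j) ^ 2 = f i * f j * (f i * f j) := by rw [pow_two]
      _ = f i * f j * (f j * f i) := by rw [hcomm i j h3.1 h3.2]
      _ = 1 := by simp only [mul_assoc, h2, hsq]

variable (cs : CoxeterSystem Mat W)

theorem simple_mul_comm (hM : IsAffineD4 Mat) {i j : Fin 5} (hi : i ≠ 2) (hj : j ≠ 2) :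
    cs.simple i * cs.simple j = cs.simple j * cs.simple i := by
  rcases eq_or_ne i j with rfl | hij
  · rfl
  have h := cs.simple_mul_simple_pow i j
  rw [show Mat i j = _ from hM i j, if_neg hij, if_neg (by tauto)] at h
  have h' := eq_inv_of_mul_eq_one_left ((pow_two _).symm.trans h)
  simpa using h'

theorem simple_braid (hM : IsAffineD4 Mat) {i : Fin 5} (hi : i ≠ 2) :
    cs.simple 2 * cs.simple i * cs.simple 2 = cs.simple i * cs.simple 2 * cs.simple i := by
  have h := cs.simple_mul_simple_pow 2 i
  rw [show Mat 2 i = _ from hM 2 i, if_neg (Ne.symm hi), if_pos (Or.inl rfl)] at h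
  have h' : (cs.simple 2 * cs.simple i * cs.simple 2) *
      (cs.simple i * cs.simple 2 * cs.simple i) = 1 := by
    rw [← h]
    simp only [pow_succ, pow_zero, one_mul, mul_assoc]
  have h'' := eq_inv_of_mul_eq_one_left h'
  simpa [mul_assoc] using h''

/-- Folding of the `D̃₄` diagram onto the `D₄` diagram with leaves `a`, `b` and one more. -/
def foldLabel (a b : Fin 5) (i : Fin 5) : Fin 4 :=
  if i = 2 then 0 else if i = a then 1 else if i = b then 2 else 3

theorem foldLabel_ne_zero {a b i : Fin 5} (hi : i ≠ 2) : foldLabel a b i ≠ 0 := by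
  unfold foldLabel
  rw [if_neg hi]
  split_ifs <;> decide

/-- Right multiplication by a generator as a permutation of the `D₄` model. -/
def actPerm (s : Fin 4) : Equiv.Perm D4Model :=
  ⟨D4Model.act s, D4Model.act s, D4Model.act_act s, D4Model.act_act s⟩

theorem exists_hom_actPerm (hM : IsAffineD4 Mat) (a b : Fin 5) :
    ∃ F : W →* Equiv.Perm D4Model, ∀ i, F (cs.simple i) = actPerm (foldLabel a b i) := by
  have hl : Mat.IsLiftable fun i => actPerm (foldLabel a b i) := by
    have h2 : foldLabel a b 2 = 0 := rfl
    apply isLiftable_of_relations hM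
    · intro i
      ext1 x
      exact D4Model.act_act _ x
    · intro i hi
      ext1 x
      simp only [h2]
      exact D4Model.act_braid _ (foldLabel_ne_zero hi) x
    · intro i j hi hj
      ext1 x
      exact D4Model.act_comm _ _ (foldLabel_ne_zero hi) (foldLabel_ne_zero hj) x
  exact ⟨cs.lift ⟨_, hl⟩, cs.lift_apply_simple hl⟩

/-- The parabolic subgroup generated by the central node and some leaves. -/
theorem poin_of_center (hM : IsAffineD4 Mat) {a b c : Fin 5} (ha : a ≠ 2) (hb : b ≠ 2)
    (hc : c ≠ 2) (hab : a ≠ b) (hac : a ≠ c) (hbc : b ≠ c) (m : Fin 5) (σ : Finset (Fin 5))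
    (hσ : ∀ i, i ∈ σ ↔ ∃ s : Fin 4, s.val < m.val ∧ ![2, a, b, c] s = i) :
    (parabolic cs σ : Set W).Finite ∧
      poin cs σ = ∑ x ∈ D4Model.below m, X ^ x.word.length := by
  obtain ⟨F, hF⟩ := exists_hom_actPerm cs hM a b
  set e : Fin 4 → Fin 5 := ![2, a, b, c] with he
  have hfold : ∀ s, foldLabel a b (e s) = s := by
    intro s
    fin_cases s <;> simp [he, foldLabel, ha, hb, hc, hab.symm, hac.symm, hbc.symm]
  let v : Fin 4 → W := fun s => cs.simple (e s)
  have hne : ∀ s, s ≠ 0 → e s ≠ 2 := by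
    intro s hs
    fin_cases s <;> simp_all
  have hprod := D4Model.prod_word_act v (fun s => cs.simple_mul_simple_self _)
    (fun s hs => simple_braid cs hM (hne s hs))
    (fun s t hs ht => simple_mul_comm cs hM (hne s hs) (hne t ht))
  -- the point of the model reached by `w`
  let pt : W → D4Model := fun w => F w⁻¹ 0
  have hpt_mul : ∀ w i, pt (w * cs.simple i) = D4Model.act (foldLabel a b i) (pt w) := by
    intro w i
    simp only [pt, mul_inv_rev, cs.inv_simple, map_mul, hF]
    rfl
  have hpt_one : pt 1 = 0 := by
    simp only [pt, inv_one, map_one]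
    rfl
  have hpt_foldl : ∀ (l : List (Fin 4)) (w : W), pt (w * (l.map v).prod) =
      l.foldl (fun y s => D4Model.act s y) (pt w) := by
    intro l
    induction l with
    | nil => simp
    | cons s l ih =>
      intro w
      rw [List.map_cons, List.prod_cons, ← mul_assoc, ih, hpt_mul, hfold, List.foldl_cons]
  have hpt_word : ∀ x : D4Model, pt (x.word.map v).prod = x := by
    intro x
    have h := hpt_foldl x.word 1
    rwa [one_mul, hpt_one, D4Model.foldl_act_word] at h
  have hlow : ∀ w, (pt w).word.length ≤ cs.length w := by
    intro w
    obtain ⟨l, hl, rfl⟩ := cs.exists_isReduced w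
    rw [hl.eq]
    clear hl
    induction l using List.reverseRecOn with
    | nil => simp [hpt_one, D4Model.word, wordA1, wordA2, wordA3, wordD4]
    | append_singleton l s ih =>
      rw [cs.wordProd_append, cs.wordProd_singleton, hpt_mul, List.length_append]
      exact (D4Model.length_word_act_le _ _).trans (Nat.add_le_add_right ih 1)
  have hup : ∀ l : List (Fin 4), cs.length (l.map v).prod ≤ l.length := by
    intro l
    have h := cs.length_wordProd_le (l.map e)
    rwa [List.length_map, CoxeterSystem.wordProd, List.map_map] at h
  apply poin_eq_sum cs (D4Model.below m) (fun x => (x.word.map v).prod)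
  · intro x hx
    apply Subgroup.list_prod_mem
    intro w hw
    obtain ⟨s, hs, rfl⟩ := List.mem_map.1 hw
    exact simple_mem_parabolic cs ((hσ _).2 ⟨s, D4Model.lt_of_mem_word m x hx s hs, rfl⟩)
  · refine ⟨0, ?_, ?_⟩
    · simp [D4Model.below]
    · simp [D4Model.word, wordA1, wordA2, wordA3, wordD4]
  · intro x hx i hi
    obtain ⟨s, hs, rfl⟩ := (hσ i).1 hi
    exact ⟨D4Model.act s x, D4Model.act_mem_below m s hs x hx, hprod s x⟩
  · intro x _ y _ hxy
    have h := congrArg pt hxy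
    simpa only [hpt_word] using h
  · intro x _
    refine le_antisymm (hup _) ?_
    have h := hlow (x.word.map v).prod
    rwa [hpt_word] at h

end AffineD4

/-- The rank of a sum of matrices over a field is at most the sum of the ranks. -/
theorem matrix_rank_add_le {m n K : Type*} [Fintype m] [Fintype n] [Field K]
    (A B : Matrix m n K) : (A + B).rank ≤ A.rank + B.rank := by
  unfold Matrix.rank
  rw [Matrix.mulVecLin_add]
  exact (Submodule.finrank_mono (LinearMap.range_add_le _ _)).trans
    (Submodule.finrank_add_le_finrank_add_finrank _ _)

/-- The simple reflections of type `D̃₄` acting on the root lattice. -/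
def reflMatrix (i : Fin 5) : Matrix (Fin 5) (Fin 5) ℤ :=
  Matrix.of fun k j => (if k = j then 1 else 0) +
    if k = i then (if i = j then -2 else if i = 2 ∨ j = 2 then 1 else 0) else 0

theorem reflMatrix_eq (i : Fin 5) : reflMatrix i = 1 + Matrix.vecMulVec (Pi.single i 1)
    (fun j => if i = j then -2 else if i = 2 ∨ j = 2 then 1 else 0) := by
  revert i
  decide +kernel

/-- The square of a Coxeter element acts on the root lattice as a translation. -/
theorem reflMatrix_coxeter_sq :
    (reflMatrix 0 * reflMatrix 1 * reflMatrix 3 * reflMatrix 4 * reflMatrix 2) ^ 2 =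
      1 + Matrix.vecMulVec ![1, 1, 2, 1, 1] ![1, 1, -2, 1, 1] := by
  decide +kernel

section AffineD4

variable {W : Type*} [Group W] {Mat : CoxeterMatrix (Fin 5)} (cs : CoxeterSystem Mat W)

theorem exists_hom_reflMatrix (hM : IsAffineD4 Mat) :
    ∃ F : W →* Matrix (Fin 5) (Fin 5) ℤ, ∀ i, F (cs.simple i) = reflMatrix i := by
  have hl : Mat.IsLiftable reflMatrix := by
    apply isLiftable_of_relations hM
    · decide +kernel
    · decide +kernel
    · decide +kernel
  exact ⟨cs.lift ⟨_, hl⟩, cs.lift_apply_simple hl⟩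

theorem infinite_of_affineD4 {W : Type*} [Group W] {Mat : CoxeterMatrix (Fin 5)}
    (cs : CoxeterSystem Mat W) (hM : IsAffineD4 Mat) : Infinite W := by
  obtain ⟨F, hF⟩ := exists_hom_reflMatrix cs hM
  let g : W := (cs.simple 0 * cs.simple 1 * cs.simple 3 * cs.simple 4 * cs.simple 2) ^ 2
  set N : Matrix (Fin 5) (Fin 5) ℤ :=
    Matrix.vecMulVec ![1, 1, 2, 1, 1] ![1, 1, -2, 1, 1] with hN
  have hNN : N * N = 0 := by
    rw [hN]
    decide +kernel
  have hg : F g = 1 + N := by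
    simp only [g, map_pow, map_mul, hF]
    exact reflMatrix_coxeter_sq
  have hpow : ∀ n : ℕ, F (g ^ n) = 1 + (n : ℤ) • N := by
    intro n
    induction n with
    | zero => simp
    | succ n ih =>
      rw [pow_succ, map_mul, ih, hg, mul_add, mul_one, add_mul, one_mul, smul_mul_assoc, hNN,
        smul_zero, add_zero, add_assoc]
      push_cast
      rw [add_smul, one_smul]
  refine Infinite.of_injective (fun n : ℕ => g ^ n) ?_
  intro m n hmn
  have h := congrFun (congrFun ((hpow m).symm.trans ((congrArg F hmn).trans (hpow n))) 0) 0
  simpa [hN, Matrix.vecMulVec_apply] using h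

/-- The codimension of the fixed space bounds the length from below. -/
theorem rank_sub_one_le_length (F : W →* Matrix (Fin 5) (Fin 5) ℤ)
    (hF : ∀ i, F (cs.simple i) = reflMatrix i) (w : W) :
    ((Int.castRingHom ℚ).mapMatrix (F w - 1)).rank ≤ cs.length w := by
  obtain ⟨l, hl, rfl⟩ := cs.exists_isReduced w
  rw [hl.eq]
  clear hl
  induction l with
  | nil => simp
  | cons i l ih =>
    rw [cs.wordProd_cons, map_mul, hF, List.length_cons]
    have h : reflMatrix i * F (cs.wordProd l) - 1 =
        reflMatrix i * (F (cs.wordProd l) - 1) + (reflMatrix i - 1) := by noncomm_ring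
    rw [h, map_add, map_mul]
    refine (matrix_rank_add_le _ _).trans
      (add_le_add ((Matrix.rank_mul_le_right _ _).trans ih) ?_)
    rw [reflMatrix_eq, add_sub_cancel_left, RingHom.mapMatrix_apply,
      show ∀ u v : Fin 5 → ℤ, (Matrix.vecMulVec u v).map (Int.castRingHom ℚ) =
        Matrix.vecMulVec (fun k => (u k : ℚ)) (fun k => (v k : ℚ)) from fun u v => by
          ext k l
          simp [Matrix.vecMulVec_apply]]
    exact Matrix.rank_vecMulVec_le _ _

theorem four_le_length_prod_leaves (hM : IsAffineD4 Mat) :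
    4 ≤ cs.length (cs.simple 0 * cs.simple 1 * cs.simple 3 * cs.simple 4) := by
  obtain ⟨F, hF⟩ := exists_hom_reflMatrix cs hM
  refine le_trans ?_ (rank_sub_one_le_length cs F hF _)
  simp only [map_mul, hF]
  refine le_trans ?_ (Matrix.rank_submatrix_le _ ![0, 1, 3, 4] ![0, 1, 3, 4])
  have h : (reflMatrix 0 * reflMatrix 1 * reflMatrix 3 * reflMatrix 4 - 1).submatrix
      ![0, 1, 3, 4] ![0, 1, 3, 4] = Matrix.diagonal (fun _ : Fin 4 => -2) := by decide +kernel
  rw [RingHom.mapMatrix_apply, Matrix.submatrix_map, h, Matrix.diagonal_map (map_zero _),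
    Matrix.rank_of_det_ne_zero]
  · simp
  · simp [Matrix.det_diagonal]

theorem pairwise_commute_leaves (hM : IsAffineD4 Mat) (T : Set (Fin 5)) :
    T.Pairwise (Function.onFun Commute fun i => if i = 2 then 1 else cs.simple i) := by
  intro i _ j _ _
  simp only [Function.onFun]
  split_ifs with hi hj hj
  · exact Commute.one_left _
  · exact Commute.one_left _
  · exact Commute.one_right _
  · exact simple_mul_comm cs hM hi hj

/-- The product of the simple reflections of a set of leaves. -/
def leafProd (hM : IsAffineD4 Mat) (T : Finset (Fin 5)) : W :=
  T.noncommProd (fun i => if i = 2 then 1 else cs.simple i) (pairwise_commute_leaves cs hM T)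

theorem leafProd_empty (hM : IsAffineD4 Mat) : leafProd cs hM ∅ = 1 :=
  Finset.noncommProd_empty _ _

theorem leafProd_insert (hM : IsAffineD4 Mat) {T : Finset (Fin 5)} {i : Fin 5} (hi : i ∉ T)
    (hi2 : i ≠ 2) : leafProd cs hM (insert i T) = leafProd cs hM T * cs.simple i := by
  unfold leafProd
  rw [Finset.noncommProd_insert_of_notMem' _ _ _ _ hi, if_neg hi2]

theorem leafProd_union (hM : IsAffineD4 Mat) {S T : Finset (Fin 5)} (h : Disjoint S T) :
    leafProd cs hM (S ∪ T) = leafProd cs hM S * leafProd cs hM T :=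
  Finset.noncommProd_union_of_disjoint h _ _

theorem length_leafProd_le (hM : IsAffineD4 Mat) (T : Finset (Fin 5)) (hT : 2 ∉ T) :
    cs.length (leafProd cs hM T) ≤ T.card := by
  induction T using Finset.induction_on with
  | empty => simp [leafProd_empty]
  | insert i T hi ih =>
    rw [Finset.mem_insert, not_or] at hT
    rw [leafProd_insert cs hM hi (Ne.symm hT.1), Finset.card_insert_of_notMem hi]
    refine (cs.length_mul_le _ _).trans ?_
    rw [cs.length_simple]
    exact Nat.add_le_add_right (ih hT.2) 1

theorem length_leafProd (hM : IsAffineD4 Mat) (T : Finset (Fin 5)) (hT : 2 ∉ T) :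
    cs.length (leafProd cs hM T) = T.card := by
  refine le_antisymm (length_leafProd_le cs hM T hT) ?_
  have hall : leafProd cs hM {4, 3, 1, 0} =
      cs.simple 0 * cs.simple 1 * cs.simple 3 * cs.simple 4 := by
    rw [leafProd_insert _ _ (by decide) (by decide), leafProd_insert _ _ (by decide) (by decide),
      leafProd_insert _ _ (by decide) (by decide),
      show ({0} : Finset (Fin 5)) = insert 0 ∅ from rfl,
      leafProd_insert _ _ (by decide) (by decide), leafProd_empty, one_mul]
  have hsub : T ⊆ {4, 3, 1, 0} := by
    revert T
    decide
  have h4 := four_le_length_prod_leaves cs hM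
  rw [← hall, ← Finset.union_sdiff_of_subset hsub,
    leafProd_union _ _ Finset.disjoint_sdiff] at h4
  have h5 := h4.trans (cs.length_mul_le _ _)
  have h6 := length_leafProd_le cs hM ({4, 3, 1, 0} \ T) (by simp)
  have h7 := Finset.card_sdiff_add_card_eq_card hsub
  have h8 : ({4, 3, 1, 0} : Finset (Fin 5)).card = 4 := rfl
  omega

theorem leafProd_mul_simple (hM : IsAffineD4 Mat) (T : Finset (Fin 5)) {i : Fin 5} (hi : i ≠ 2) :
    leafProd cs hM T * cs.simple i =
      leafProd cs hM (if i ∈ T then T.erase i else insert i T) := by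
  split_ifs with h
  · conv_lhs => rw [← Finset.insert_erase h, leafProd_insert _ _ (Finset.notMem_erase i T) hi]
    rw [mul_assoc, cs.simple_mul_simple_self, mul_one]
  · rw [leafProd_insert _ _ h hi]

theorem leafProd_injOn (hM : IsAffineD4 Mat) :
    Set.InjOn (leafProd cs hM) {T | 2 ∉ T} := by
  -- multiplying by the product over `T` translates by symmetric difference
  have key : ∀ T : Finset (Fin 5), 2 ∉ T → ∀ S,
      leafProd cs hM S * leafProd cs hM T = leafProd cs hM (symmDiff S T) := by
    intro T
    induction T using Finset.induction_on with
    | empty =>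
      intro _ S
      rw [leafProd_empty, mul_one, ← Finset.bot_eq_empty, symmDiff_bot]
    | insert i T hi ih =>
      intro hT S
      rw [Finset.mem_insert, not_or] at hT
      rw [leafProd_insert _ _ hi (Ne.symm hT.1), ← mul_assoc, ih hT.2,
        leafProd_mul_simple _ _ _ (Ne.symm hT.1)]
      congr 1
      ext j
      by_cases hj : j = i
      · subst hj
        split_ifs with h <;> simp_all [Finset.mem_symmDiff]
      · split_ifs with h <;> simp [Finset.mem_symmDiff, hj]
  intro S hS T hT h
  have h1 := key S hS S
  rw [symmDiff_self, Finset.bot_eq_empty, leafProd_empty] at h1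
  have h2 := key T hT S
  rw [← h, h1] at h2
  have hST : 2 ∉ symmDiff S T := by
    simp only [Finset.mem_symmDiff, Set.mem_ofPred_eq] at *
    tauto
  have h3 := length_leafProd cs hM _ hST
  rw [← h2, cs.length_one] at h3
  exact symmDiff_eq_bot.1 (Finset.card_eq_zero.1 h3.symm)

/-- The parabolic subgroup generated by some leaves. -/
theorem poin_of_leaves (hM : IsAffineD4 Mat) (σ : Finset (Fin 5)) (hσ : 2 ∉ σ) :
    (parabolic cs σ : Set W).Finite ∧ poin cs σ = (1 + X) ^ σ.card := by
  have h := poin_eq_sum cs σ.powerset (leafProd cs hM) Finset.card (σ := σ) ?_ ?_ ?_ ?_ ?_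
  · refine ⟨h.1, h.2.trans ?_⟩
    have h' := Finset.sum_pow_mul_eq_add_pow (X : ℚ[X]) 1 σ
    simpa [add_comm] using h'
  · intro T hT
    apply Subgroup.noncommProd_mem
    intro i hi
    split_ifs
    · exact one_mem _
    · exact simple_mem_parabolic cs (Finset.mem_powerset.1 hT hi)
  · exact ⟨∅, by simp, leafProd_empty cs hM⟩
  · intro T hT i hi
    rw [Finset.mem_powerset] at hT
    refine ⟨_, ?_, (leafProd_mul_simple cs hM T (fun h => hσ (h ▸ hi))).symm⟩
    rw [Finset.mem_powerset]
    split_ifs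
    · exact (Finset.erase_subset _ _).trans hT
    · exact Finset.insert_subset hi hT
  · exact (leafProd_injOn cs hM).mono fun T hT h =>
      hσ (Finset.mem_powerset.1 (Finset.mem_coe.1 hT) h)
  · exact fun T hT => length_leafProd cs hM T fun h => hσ (Finset.mem_powerset.1 hT h)

/-- The Poincaré polynomials of the proper parabolic subgroups in type `D̃₄`. -/
noncomputable def poinD4 (center : Prop) [Decidable center] (k : ℕ) : ℚ[X] :=
  if center then
    (if 0 < k then 1 + X else 1) * ((if 1 < k then 1 + X + X ^ 2 else 1) *
      ((if 2 < k then 1 + X + X ^ 2 + X ^ 3 else 1) *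
        (if 3 < k then (1 + X ^ 3) * (1 + X + X ^ 2 + X ^ 3) else 1)))
  else (1 + X) ^ k

theorem D4Model.sum_below_eq (m : ℕ) :
    ∑ x ∈ D4Model.below m, (X : ℚ[X]) ^ x.word.length = poinD4 True m := by
  rw [D4Model.sum_below, poinD4, if_pos trivial]
  congr 1
  · by_cases h : 0 < m <;> simp [h, wordA1, Fin.sum_univ_succ, Finset.filter_eq']
  congr 1
  · by_cases h : 1 < m <;> simp [h, wordA2, Fin.sum_univ_succ, Finset.filter_eq']
    ring
  congr 1
  · by_cases h : 2 < m <;> simp [h, wordA3, Fin.sum_univ_succ, Finset.filter_eq']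
    ring
  · by_cases h : 3 < m <;> simp [h, wordD4, Fin.sum_univ_succ, Finset.filter_eq']
    ring

theorem poin_affineD4 (hM : IsAffineD4 Mat) (σ : Finset (Fin 5)) (hσ : σ.card ≤ 4) :
    (parabolic cs σ : Set W).Finite ∧ poin cs σ = poinD4 (2 ∈ σ) σ.card := by
  by_cases h2 : 2 ∈ σ
  · have hlist : ∃ a b c : Fin 5, (a ≠ 2 ∧ b ≠ 2 ∧ c ≠ 2 ∧ a ≠ b ∧ a ≠ c ∧ b ≠ c) ∧
        ∀ i, i ∈ σ ↔ ∃ s : Fin 4, s.val < σ.card ∧ ![2, a, b, c] s = i := by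
      revert σ
      decide +kernel
    obtain ⟨a, b, c, ⟨ha, hb, hc, hab, hac, hbc⟩, h⟩ := hlist
    have h' := poin_of_center cs hM ha hb hc hab hac hbc ⟨σ.card, by omega⟩ σ h
    refine ⟨h'.1, h'.2.trans ?_⟩
    rw [D4Model.sum_below_eq]
    simp [poinD4, h2]
  · have h' := poin_of_leaves cs hM σ h2
    refine ⟨h'.1, h'.2.trans ?_⟩
    simp [poinD4, h2]

theorem finite_parabolic_iff (hM : IsAffineD4 Mat) (σ : Finset (Fin 5)) :
    (parabolic cs σ : Set W).Finite ↔ σ.card ≤ 4 := by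
  refine ⟨fun h => ?_, fun h => (poin_affineD4 cs hM σ h).1⟩
  by_contra hc
  have huniv : σ = Finset.univ := by
    rw [← Finset.card_eq_iff_eq_univ, Fintype.card_fin]
    have := σ.card_le_univ
    rw [Fintype.card_fin] at this
    omega
  subst huniv
  have := infinite_of_affineD4 cs hM
  have htop : parabolic cs Finset.univ = ⊤ := by
    rw [parabolic, Finset.coe_univ, Set.image_univ, cs.subgroup_closure_range_simple]
  rw [htop, Subgroup.coe_top] at h
  exact Set.infinite_univ h

end AffineD4

namespace D4Homology

variable {A : Type*} [CommRing A]

/-- The boundary map from degree `1` to degree `0` in coordinates. -/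
def bd1 (q : A) (x : Fin 5 → A) : Fin 1 → A :=
  ![(1 + q) * (x 0 + x 1 + x 2 + x 3 + x 4)]

/-- The boundary map from degree `2` to degree `1` in coordinates. -/
def bd2 (q : A) (x : Fin 10 → A) : Fin 5 → A :=
  ![(1 + q) * (-x 0 - x 1 - x 2) + (1 + q + q ^ 2) * (-x 6),
    (1 + q) * (x 0 - x 3 - x 4) + (1 + q + q ^ 2) * (-x 7),
    (1 + q) * (x 1 + x 3 - x 5) + (1 + q + q ^ 2) * (x 8),
    (1 + q) * (x 2 + x 4 + x 5) + (1 + q + q ^ 2) * (x 9),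
    (1 + q + q ^ 2) * (x 6 + x 7 - x 8 - x 9)]

/-- The boundary map from degree `3` to degree `2` in coordinates. -/
def bd3 (q : A) (x : Fin 10 → A) : Fin 10 → A :=
  ![(1 + q) * (x 0 + x 1) + ((1 + q + q ^ 2) * (1 + q ^ 2)) * (x 4),
    (1 + q) * (-x 0 + x 2) + ((1 + q + q ^ 2) * (1 + q ^ 2)) * (-x 5),
    (1 + q) * (-x 1 - x 2) + ((1 + q + q ^ 2) * (1 + q ^ 2)) * (-x 6),
    (1 + q) * (x 0 + x 3) + ((1 + q + q ^ 2) * (1 + q ^ 2)) * (-x 7),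
    (1 + q) * (x 1 - x 3) + ((1 + q + q ^ 2) * (1 + q ^ 2)) * (-x 8),
    (1 + q) * (x 2 + x 3) + ((1 + q + q ^ 2) * (1 + q ^ 2)) * (x 9),
    ((1 + q) * (1 + q ^ 2)) * (-x 4 + x 5 + x 6),
    ((1 + q) * (1 + q ^ 2)) * (x 4 + x 7 + x 8),
    ((1 + q) * (1 + q ^ 2)) * (x 5 + x 7 + x 9),
    ((1 + q) * (1 + q ^ 2)) * (x 6 + x 8 - x 9)]

/-- The boundary map from degree `4` to degree `3` in coordinates. -/
def bd4 (q : A) (x : Fin 5 → A) : Fin 10 → A :=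
  ![(1 + q) * (-x 0) + ((1 + q + q ^ 2) * (1 + q ^ 2) ^ 2 * (1 + q ^ 3)) * (x 1),
    (1 + q) * (x 0) + ((1 + q + q ^ 2) * (1 + q ^ 2) ^ 2 * (1 + q ^ 3)) * (x 2),
    (1 + q) * (-x 0) + ((1 + q + q ^ 2) * (1 + q ^ 2) ^ 2 * (1 + q ^ 3)) * (-x 3),
    (1 + q) * (x 0) + ((1 + q + q ^ 2) * (1 + q ^ 2) ^ 2 * (1 + q ^ 3)) * (-x 4),
    ((1 + q) * (1 + q ^ 2) * (1 + q ^ 3)) * (-x 1 - x 2),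
    ((1 + q) * (1 + q ^ 2) * (1 + q ^ 3)) * (-x 1 - x 3),
    ((1 + q) * (1 + q ^ 2) * (1 + q ^ 3)) * (-x 2 + x 3),
    ((1 + q) * (1 + q ^ 2) * (1 + q ^ 3)) * (x 1 - x 4),
    ((1 + q) * (1 + q ^ 2) * (1 + q ^ 3)) * (x 2 + x 4),
    ((1 + q) * (1 + q ^ 2) * (1 + q ^ 3)) * (x 3 + x 4)]

/-- Coordinates detecting the homology in degree `1`. -/
def pr1 : (Fin 5 → A) →ₗ[A] (Fin 1 → A) where
  toFun x := ![x 4]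
  map_add' x y := by
    ext i; fin_cases i; simp
  map_smul' r x := by
    ext i; fin_cases i; simp

lemma pr1_bd2 (q : A) (x : Fin 10 → A) (i : Fin 1) :
    ∃ c, pr1 (bd2 q x) i = (1 + q + q ^ 2) * c := by
  fin_cases i
  · refine ⟨x 6 + x 7 - x 8 - x 9, ?_⟩
    simp [pr1, bd2]

lemma exists_bd2_eq [IsDomain A] (q : A) (hu : 1 + q ≠ 0)
    (x : Fin 5 → A) (hx : bd1 q x = 0)
    (hp : ∀ i, ∃ c, pr1 x i = (1 + q + q ^ 2) * c) :
    ∃ y, bd2 q y = x := by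
  have k0 := congrFun hx 0
  simp only [bd1, Matrix.cons_val, Pi.zero_apply] at k0
  obtain ⟨e0, p0⟩ := hp 0
  simp [pr1] at p0
  have y0 : (1 + q + q ^ 2) * e0 = x 4 := by linear_combination -p0
  have a0 : -((1 + q + q ^ 2) * e0) = x 0 + x 1 + x 2 + x 3 := mul_left_cancel₀ hu (by linear_combination (1 + q) * p0 - (k0))
  obtain ⟨g01, f01, b01⟩ : ∃ f g, (1 + q) * f - (1 + q + q ^ 2) * g = x 1 :=
    ⟨(-(q * (x 1))), (-(x 1)), by ring⟩
  obtain ⟨g03, f03, b03⟩ : ∃ f g, (1 + q) * f - (1 + q + q ^ 2) * g = x 2 :=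
    ⟨(-(q * (x 2))), (-(x 2)), by ring⟩
  obtain ⟨g04, f04, b04⟩ : ∃ f g, (1 + q) * f - (1 + q + q ^ 2) * g = x 3 :=
    ⟨(-(q * (x 3))), (-(x 3)), by ring⟩
  refine ⟨![g01, g03, g04, 0, 0, 0, e0 - f01 - f03 - f04, f01, -f03, -f04], ?_⟩
  ext i
  fin_cases i
  · simp [bd2]
    linear_combination a0 - b01 - b03 - b04
  · simp [bd2]
    linear_combination b01
  · simp [bd2]
    linear_combination b03
  · simp [bd2]
    linear_combination b04
  · simp [bd2]
    linear_combination y0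

lemma exists_pr1_eq (q : A) (z : Fin 1 → A) :
    ∃ x, bd1 q x = 0 ∧ pr1 x = z := by
  refine ⟨![(-z 0), 0, 0, 0, (z 0)], ?_, ?_⟩
  · ext i
    fin_cases i; simp [bd1]
  · ext i
    fin_cases i; simp [pr1]

/-- Coordinates detecting the homology in degree `2`. -/
def pr2 (q : A) : (Fin 10 → A) →ₗ[A] (Fin 3 → A) where
  toFun x := ![x 0 - x 3 - x 4 - q * (x 7),
    x 1 + x 3 - x 5 - q * (-x 8),
    x 2 + x 4 + x 5 - q * (-x 9)]
  map_add' x y := by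
    ext i; fin_cases i <;> simp <;> ring
  map_smul' r x := by
    ext i; fin_cases i <;> simp <;> ring

lemma pr2_bd3 (q : A) (x : Fin 10 → A) (i : Fin 3) :
    ∃ c, pr2 q (bd3 q x) i = (1 + q ^ 2) * c := by
  fin_cases i
  · refine ⟨x 4 + x 7 + x 8, ?_⟩
    simp [pr2, bd3]
    ring
  · refine ⟨-x 5 - x 7 - x 9, ?_⟩
    simp [pr2, bd3]
    ring
  · refine ⟨-x 6 - x 8 + x 9, ?_⟩
    simp [pr2, bd3]
    ring

lemma exists_bd3_eq [IsDomain A] (q : A) (h : A) (hh : 2 * h = 1) (h3 : 1 + q + q ^ 2 ≠ 0)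
    (x : Fin 10 → A) (hx : bd2 q x = 0)
    (hp : ∀ i, ∃ c, pr2 q x i = (1 + q ^ 2) * c) :
    ∃ y, bd3 q y = x := by
  have k0 := congrFun hx 0
  have k1 := congrFun hx 1
  have k2 := congrFun hx 2
  have k3 := congrFun hx 3
  have k4 := congrFun hx 4
  simp only [bd2, Matrix.cons_val, Pi.zero_apply] at k0 k1 k2 k3 k4
  obtain ⟨e0, p0⟩ := hp 0
  obtain ⟨e1, p1⟩ := hp 1
  obtain ⟨e2, p2⟩ := hp 2
  simp [pr2] at p0 p1 p2
  have y01 : ((1 + q) * (1 + q ^ 2)) * e0 = x 7 := by linear_combination -(1 + q) * p0 + (k1)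
  have a01 : ((1 + q + q ^ 2) * (1 + q ^ 2)) * e0 = x 0 - x 3 - x 4 := by linear_combination -p0 + q * y01
  have y03 : ((1 + q) * (1 + q ^ 2)) * e1 = -x 8 := by linear_combination -(1 + q) * p1 + (k2)
  have a03 : ((1 + q + q ^ 2) * (1 + q ^ 2)) * e1 = x 1 + x 3 - x 5 := by linear_combination -p1 + q * y03
  have y04 : ((1 + q) * (1 + q ^ 2)) * e2 = -x 9 := by linear_combination -(1 + q) * p2 + (k3)
  have a04 : ((1 + q + q ^ 2) * (1 + q ^ 2)) * e2 = x 2 + x 4 + x 5 := by linear_combination -p2 + q * y04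
  have z0 : 0 = x 6 + x 7 - x 8 - x 9 := mul_left_cancel₀ h3 (by linear_combination -(k4))
  obtain ⟨g013, f013, b013⟩ : ∃ f g, (1 + q) * f + ((1 + q + q ^ 2) * (1 + q ^ 2)) * g = x 3 :=
    ⟨(h * (1 - 2 * q - q ^ 3) * (x 3)), (h * (x 3)), by linear_combination (x 3) * hh⟩
  obtain ⟨g014, f014, b014⟩ : ∃ f g, (1 + q) * f + ((1 + q + q ^ 2) * (1 + q ^ 2)) * g = x 4 :=
    ⟨(h * (1 - 2 * q - q ^ 3) * (x 4)), (h * (x 4)), by linear_combination (x 4) * hh⟩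
  obtain ⟨g034, f034, b034⟩ : ∃ f g, (1 + q) * f + ((1 + q + q ^ 2) * (1 + q ^ 2)) * g = x 5 :=
    ⟨(h * (1 - 2 * q - q ^ 3) * (x 5)), (h * (x 5)), by linear_combination (x 5) * hh⟩
  refine ⟨![g013, g014, g034, 0, e0 + f013 + f014, -e1 + f013 - f034, -e2 + f014 + f034, -f013, -f014, f034], ?_⟩
  ext i
  fin_cases i
  · simp [bd3]
    linear_combination a01 + b013 + b014
  · simp [bd3]
    linear_combination a03 - b013 + b034
  · simp [bd3]
    linear_combination a04 - b014 - b034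
  · simp [bd3]
    linear_combination b013
  · simp [bd3]
    linear_combination b014
  · simp [bd3]
    linear_combination b034
  · simp [bd3]
    linear_combination z0 - y01 - y03 - y04
  · simp [bd3]
    linear_combination y01
  · simp [bd3]
    linear_combination -y03
  · simp [bd3]
    linear_combination -y04

lemma exists_pr2_eq (q : A) (z : Fin 3 → A) :
    ∃ x, bd2 q x = 0 ∧ pr2 q x = z := by
  refine ⟨![((1 + q + q ^ 2) * z 0), ((1 + q + q ^ 2) * z 1), ((1 + q + q ^ 2) * z 2), 0, 0, 0, -((1 + q) * z 0) - ((1 + q) * z 1) - ((1 + q) * z 2), ((1 + q) * z 0), -((1 + q) * z 1), -((1 + q) * z 2)], ?_, ?_⟩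
  · ext i
    fin_cases i <;> simp [bd2] <;> ring
  · ext i
    fin_cases i <;> simp [pr2] <;> ring

/-- Coordinates detecting the homology in degree `3`. -/
def pr3 (q h : A) : (Fin 10 → A) →ₗ[A] (Fin 4 → A) where
  toFun x := ![x 3,
    h * (1 - 2 * q - q ^ 3) * (-x 7) - h * (x 0 + x 3),
    h * (1 - 2 * q - q ^ 3) * (-x 8) - h * (x 1 - x 3),
    h * (1 - 2 * q - q ^ 3) * (x 9) - h * (x 2 + x 3)]
  map_add' x y := by
    ext i; fin_cases i <;> simp <;> ring
  map_smul' r x := by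
    ext i; fin_cases i <;> simp <;> ring

lemma pr3_bd4 (q h : A) (hh : 2 * h = 1) (x : Fin 5 → A) (i : Fin 4) :
    ∃ c, pr3 q h (bd4 q x) i = (if i = 0 then 1 + q else ((1 + q ^ 2) * (1 + q ^ 3))) * c := by
  fin_cases i
  · refine ⟨x 0 - (1 + q + q ^ 2) * (1 + q ^ 2) ^ 2 * (1 - q + q ^ 2) * x 4, ?_⟩
    simp [pr3, bd4]
    ring
  · refine ⟨-x 1 + x 4, ?_⟩
    simp [pr3, bd4]
    linear_combination ((-x 1 + x 4) * (1 + q ^ 2) * (1 + q ^ 3)) * hh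
  · refine ⟨-x 2 - x 4, ?_⟩
    simp [pr3, bd4]
    linear_combination ((-x 2 - x 4) * (1 + q ^ 2) * (1 + q ^ 3)) * hh
  · refine ⟨x 3 + x 4, ?_⟩
    simp [pr3, bd4]
    linear_combination ((x 3 + x 4) * (1 + q ^ 2) * (1 + q ^ 3)) * hh

lemma exists_bd4_eq [IsDomain A] (q : A) (h : A) (hh : 2 * h = 1) (hu : 1 + q ≠ 0) (h4 : 1 + q ^ 2 ≠ 0)
    (x : Fin 10 → A) (hx : bd3 q x = 0)
    (hp : ∀ i, ∃ c, pr3 q h x i = (if i = 0 then 1 + q else ((1 + q ^ 2) * (1 + q ^ 3))) * c) :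
    ∃ y, bd4 q y = x := by
  have k0 := congrFun hx 0
  have k1 := congrFun hx 1
  have k2 := congrFun hx 2
  have k3 := congrFun hx 3
  have k4 := congrFun hx 4
  have k5 := congrFun hx 5
  have k6 := congrFun hx 6
  have k7 := congrFun hx 7
  have k8 := congrFun hx 8
  have k9 := congrFun hx 9
  simp only [bd3, Matrix.cons_val, Pi.zero_apply] at k0 k1 k2 k3 k4 k5 k6 k7 k8 k9
  obtain ⟨e0, p0⟩ := hp 0
  obtain ⟨e1, p1⟩ := hp 1
  obtain ⟨e2, p2⟩ := hp 2
  obtain ⟨e3, p3⟩ := hp 3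
  simp [pr3] at p0 p1 p2 p3
  have y013 : ((1 + q) * (1 + q ^ 2) * (1 + q ^ 3)) * e1 = -x 7 := by linear_combination -(1 + q) * p1 - h * (k3) + (-x 7) * hh
  have a013 : -(((1 + q + q ^ 2) * (1 + q ^ 2) ^ 2 * (1 + q ^ 3)) * e1) = x 0 + x 3 := by linear_combination ((1 + q + q ^ 2) * (1 + q ^ 2)) * p1 - h * (1 - 2 * q - q ^ 3) * (k3) + (x 0 + x 3) * hh
  have y014 : ((1 + q) * (1 + q ^ 2) * (1 + q ^ 3)) * e2 = -x 8 := by linear_combination -(1 + q) * p2 - h * (k4) + (-x 8) * hh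
  have a014 : -(((1 + q + q ^ 2) * (1 + q ^ 2) ^ 2 * (1 + q ^ 3)) * e2) = x 1 - x 3 := by linear_combination ((1 + q + q ^ 2) * (1 + q ^ 2)) * p2 - h * (1 - 2 * q - q ^ 3) * (k4) + (x 1 - x 3) * hh
  have y034 : ((1 + q) * (1 + q ^ 2) * (1 + q ^ 3)) * e3 = x 9 := by linear_combination -(1 + q) * p3 - h * (k5) + (x 9) * hh
  have a034 : -(((1 + q + q ^ 2) * (1 + q ^ 2) ^ 2 * (1 + q ^ 3)) * e3) = x 2 + x 3 := by linear_combination ((1 + q + q ^ 2) * (1 + q ^ 2)) * p3 - h * (1 - 2 * q - q ^ 3) * (k5) + (x 2 + x 3) * hh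
  have z01 : 0 = x 4 + x 7 + x 8 := mul_left_cancel₀ (mul_ne_zero hu h4) (by linear_combination -(k7))
  have z03 : 0 = -x 5 - x 7 - x 9 := mul_left_cancel₀ (mul_ne_zero hu h4) (by linear_combination -(-k8))
  have z04 : 0 = -x 6 - x 8 + x 9 := mul_left_cancel₀ (mul_ne_zero hu h4) (by linear_combination -(-k9))
  refine ⟨![e0, -e1, -e2, e3, 0], ?_⟩
  ext i
  fin_cases i
  · simp [bd4]
    linear_combination a013 + p0
  · simp [bd4]
    linear_combination a014 - p0
  · simp [bd4]
    linear_combination a034 + p0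
  · simp [bd4]
    linear_combination -p0
  · simp [bd4]
    linear_combination z01 + y013 + y014
  · simp [bd4]
    linear_combination -z03 + y013 - y034
  · simp [bd4]
    linear_combination -z04 + y014 + y034
  · simp [bd4]
    linear_combination -y013
  · simp [bd4]
    linear_combination -y014
  · simp [bd4]
    linear_combination y034

lemma exists_pr3_eq (q : A) (h : A) (hh : 2 * h = 1) (z : Fin 4 → A) :
    ∃ x, bd3 q x = 0 ∧ pr3 q h x = z := by
  refine ⟨![(-(((1 + q + q ^ 2) * (1 + q ^ 2)) * z 1)) - z 0, (-(((1 + q + q ^ 2) * (1 + q ^ 2)) * z 2)) + z 0, (-(((1 + q + q ^ 2) * (1 + q ^ 2)) * z 3)) - z 0, z 0, ((1 + q) * z 1) + ((1 + q) * z 2), ((1 + q) * z 1) - ((1 + q) * z 3), ((1 + q) * z 2) + ((1 + q) * z 3), -((1 + q) * z 1), -((1 + q) * z 2), ((1 + q) * z 3)], ?_, ?_⟩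
  · ext i
    fin_cases i <;> simp [bd3] <;> ring
  · ext i
    fin_cases i
    · simp [pr3]
    · simp [pr3]
      linear_combination z 1 * hh
    · simp [pr3]
      linear_combination z 2 * hh
    · simp [pr3]
      linear_combination z 3 * hh

/-- Coordinates detecting the homology in degree `4`. -/
def pr4 : (Fin 5 → A) →ₗ[A] (Fin 1 → A) where
  toFun x := ![x 4]
  map_add' x y := by
    ext i; fin_cases i; simp
  map_smul' r x := by
    ext i; fin_cases i; simp

lemma eq_of_bd4 [IsDomain A] (q : A) (hu : 1 + q ≠ 0) (h4 : 1 + q ^ 2 ≠ 0) (h6 : 1 - q + q ^ 2 ≠ 0)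
    (x : Fin 5 → A) (hx : bd4 q x = 0) (hp : pr4 x = 0) : x = 0 := by
  have k0 := congrFun hx 0
  have k1 := congrFun hx 1
  have k2 := congrFun hx 2
  have k3 := congrFun hx 3
  have k4 := congrFun hx 4
  have k5 := congrFun hx 5
  have k6 := congrFun hx 6
  have k7 := congrFun hx 7
  have k8 := congrFun hx 8
  have k9 := congrFun hx 9
  simp only [bd4, Matrix.cons_val, Pi.zero_apply] at k0 k1 k2 k3 k4 k5 k6 k7 k8 k9
  have p0 := congrFun hp 0
  simp only [pr4, LinearMap.coe_mk, AddHom.coe_mk, Matrix.cons_val, Pi.zero_apply] at p0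
  have y0134 : 0 = x 4 := by linear_combination -p0
  have a0134 : 0 = x 0 := mul_left_cancel₀ hu (by linear_combination -(k3) - ((1 + q + q ^ 2) * (1 + q ^ 2) ^ 2 * (1 + q ^ 3)) * p0)
  have z013 : 0 = -x 1 + x 4 := mul_left_cancel₀ (mul_ne_zero (mul_ne_zero hu h4) (mul_ne_zero hu h6)) (by linear_combination -(-k7))
  have z014 : 0 = -x 2 - x 4 := mul_left_cancel₀ (mul_ne_zero (mul_ne_zero hu h4) (mul_ne_zero hu h6)) (by linear_combination -(-k8))
  have z034 : 0 = x 3 + x 4 := mul_left_cancel₀ (mul_ne_zero (mul_ne_zero hu h4) (mul_ne_zero hu h6)) (by linear_combination -(k9))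
  ext i
  fin_cases i
  · simp
    linear_combination -(a0134)
  · simp
    linear_combination -(-z013 + y0134)
  · simp
    linear_combination -(-z014 - y0134)
  · simp
    linear_combination -(z034 - y0134)
  · simp
    linear_combination -(y0134)

lemma exists_pr4_eq (q : A) (z : Fin 1 → A) :
    ∃ x, bd4 q x = 0 ∧ pr4 x = z := by
  refine ⟨![(((1 + q + q ^ 2) * (1 + q ^ 2)) * (1 + q ^ 2) * (1 - q + q ^ 2) * z 0), (z 0), -(z 0), -(z 0), (z 0)], ?_, ?_⟩
  · ext i
    fin_cases i <;> simp [bd4] <;> ring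
  · ext i
    fin_cases i; simp [pr4]

end D4Homology

namespace D4Homology

variable {A : Type*} [CommRing A]

/-- The incidence number of `τ` in `σ` in the simplicial complex on `Fin 5`. -/
def incidence (σ τ : Finset (Fin 5)) : ℤ :=
  ∑ s ∈ σ, if τ = σ.erase s then (-1) ^ (σ.filter (fun t => t < s)).card else 0

/-- The quotient of Poincaré polynomials for removing one node from a `k`-element subset of the
`D̃₄` diagram; `center` and `center'` say whether the central node lies in the set before and
after the removal. -/
def weight (q : A) (center center' : Prop) [Decidable center] [Decidable center'] (k : ℕ) : A :=
  if center then
    if center' then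
      if k = 2 then 1 + q + q ^ 2
      else if k = 3 then (1 + q) * (1 + q ^ 2)
      else (1 + q) * (1 + q ^ 2) * (1 + q ^ 3)
    else
      if k = 1 then 1 + q
      else if k = 2 then 1 + q + q ^ 2
      else if k = 3 then (1 + q + q ^ 2) * (1 + q ^ 2)
      else (1 + q + q ^ 2) * (1 + q ^ 2) ^ 2 * (1 + q ^ 3)
  else 1 + q

lemma sum_univ_fin_ten (f : Fin 10 → A) :
    ∑ i, f i = f 0 + f 1 + f 2 + f 3 + f 4 + f 5 + f 6 + f 7 + f 8 + f 9 := by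
  simp only [Fin.sum_univ_castSucc, Finset.univ_eq_empty, Finset.sum_empty, zero_add]
  rfl

/-- The simplices of cardinality `0`, those avoiding the central node first. -/
def faces0 : Fin 1 → Finset (Fin 5) :=
  ![∅]

/-- The simplices of cardinality `1`, those avoiding the central node first. -/
def faces1 : Fin 5 → Finset (Fin 5) :=
  ![{0}, {1}, {3}, {4}, {2}]

/-- The simplices of cardinality `2`, those avoiding the central node first. -/
def faces2 : Fin 10 → Finset (Fin 5) :=
  ![{0, 1}, {0, 3}, {0, 4}, {1, 3}, {1, 4}, {3, 4}, {0, 2}, {1, 2}, {2, 3}, {2, 4}]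

/-- The simplices of cardinality `3`, those avoiding the central node first. -/
def faces3 : Fin 10 → Finset (Fin 5) :=
  ![{0, 1, 3}, {0, 1, 4}, {0, 3, 4}, {1, 3, 4}, {0, 1, 2}, {0, 2, 3}, {0, 2, 4}, {1, 2, 3}, {1, 2, 4}, {2, 3, 4}]

/-- The simplices of cardinality `4`, those avoiding the central node first. -/
def faces4 : Fin 5 → Finset (Fin 5) :=
  ![{0, 1, 3, 4}, {0, 1, 2, 3}, {0, 1, 2, 4}, {0, 2, 3, 4}, {1, 2, 3, 4}]

lemma incidence_faces1 (i : Fin 1) (j : Fin 5) :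
    incidence (faces1 j) (faces0 i) = (![![1, 1, 1, 1, 1]] : Fin 1 → Fin 5 → ℤ) i j := by
  decide +revert +kernel

lemma sum_incidence_faces1 (q : A) (y : Fin 5 → A) (i : Fin 1) :
    ∑ j, (incidence (faces1 j) (faces0 i) : A) *
      weight q (2 ∈ faces1 j) (2 ∈ faces0 i) 1 * y j = bd1 q y i := by
  simp only [incidence_faces1]
  fin_cases i
  simp [Fin.sum_univ_five, faces0, faces1, weight, bd1]
  ring

lemma incidence_faces2 (i : Fin 5) (j : Fin 10) :
    incidence (faces2 j) (faces1 i) = (![![-1, -1, -1, 0, 0, 0, -1, 0, 0, 0],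
      ![1, 0, 0, -1, -1, 0, 0, -1, 0, 0],
      ![0, 1, 0, 1, 0, -1, 0, 0, 1, 0],
      ![0, 0, 1, 0, 1, 1, 0, 0, 0, 1],
      ![0, 0, 0, 0, 0, 0, 1, 1, -1, -1]] : Fin 5 → Fin 10 → ℤ) i j := by
  decide +revert +kernel

lemma sum_incidence_faces2 (q : A) (y : Fin 10 → A) (i : Fin 5) :
    ∑ j, (incidence (faces2 j) (faces1 i) : A) *
      weight q (2 ∈ faces2 j) (2 ∈ faces1 i) 2 * y j = bd2 q y i := by
  simp only [incidence_faces2]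
  fin_cases i <;>
    simp [sum_univ_fin_ten, faces1, faces2, weight, bd2] <;> ring

lemma incidence_faces3 (i : Fin 10) (j : Fin 10) :
    incidence (faces3 j) (faces2 i) = (![![1, 1, 0, 0, 1, 0, 0, 0, 0, 0],
      ![-1, 0, 1, 0, 0, -1, 0, 0, 0, 0],
      ![0, -1, -1, 0, 0, 0, -1, 0, 0, 0],
      ![1, 0, 0, 1, 0, 0, 0, -1, 0, 0],
      ![0, 1, 0, -1, 0, 0, 0, 0, -1, 0],
      ![0, 0, 1, 1, 0, 0, 0, 0, 0, 1],
      ![0, 0, 0, 0, -1, 1, 1, 0, 0, 0],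
      ![0, 0, 0, 0, 1, 0, 0, 1, 1, 0],
      ![0, 0, 0, 0, 0, 1, 0, 1, 0, 1],
      ![0, 0, 0, 0, 0, 0, 1, 0, 1, -1]] : Fin 10 → Fin 10 → ℤ) i j := by
  decide +revert +kernel

lemma sum_incidence_faces3 (q : A) (y : Fin 10 → A) (i : Fin 10) :
    ∑ j, (incidence (faces3 j) (faces2 i) : A) *
      weight q (2 ∈ faces3 j) (2 ∈ faces2 i) 3 * y j = bd3 q y i := by
  simp only [incidence_faces3]
  fin_cases i <;>
    simp [sum_univ_fin_ten, faces2, faces3, weight, bd3] <;> ring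

lemma incidence_faces4 (i : Fin 10) (j : Fin 5) :
    incidence (faces4 j) (faces3 i) = (![![-1, 1, 0, 0, 0],
      ![1, 0, 1, 0, 0],
      ![-1, 0, 0, -1, 0],
      ![1, 0, 0, 0, -1],
      ![0, -1, -1, 0, 0],
      ![0, -1, 0, -1, 0],
      ![0, 0, -1, 1, 0],
      ![0, 1, 0, 0, -1],
      ![0, 0, 1, 0, 1],
      ![0, 0, 0, 1, 1]] : Fin 10 → Fin 5 → ℤ) i j := by
  decide +revert +kernel

lemma sum_incidence_faces4 (q : A) (y : Fin 5 → A) (i : Fin 10) :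
    ∑ j, (incidence (faces4 j) (faces3 i) : A) *
      weight q (2 ∈ faces4 j) (2 ∈ faces3 i) 4 * y j = bd4 q y i := by
  simp only [incidence_faces4]
  fin_cases i <;>
    simp [Fin.sum_univ_five, faces3, faces4, weight, bd4] <;> ring

end D4Homology

namespace D4Homology

lemma map_weight {A A' : Type*} [CommRing A] [CommRing A'] (f : A →+* A') (q : A)
    (c c' : Prop) [Decidable c] [Decidable c'] (k : ℕ) :
    f (weight q c c' k) = weight (f q) c c' k := by
  unfold weight
  split_ifs <;> simp

variable {W : Type*} [Group W] {Mat : CoxeterMatrix (Fin 5)} (cs : CoxeterSystem Mat W)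

lemma poin_eq_poin_erase_mul (hM : IsAffineD4 Mat) {σ : Finset (Fin 5)} (hσ : σ.card ≤ 4)
    {s : Fin 5} (hs : s ∈ σ) :
    poin cs σ = poin cs (σ.erase s) * weight X (2 ∈ σ) (2 ∈ σ.erase s) σ.card := by
  have hc := Finset.card_erase_of_mem hs
  have hpos : 0 < σ.card := Finset.card_pos.2 ⟨s, hs⟩
  rw [(poin_affineD4 cs hM σ hσ).2, (poin_affineD4 cs hM (σ.erase s) (by omega)).2, hc]
  obtain ⟨n, hn⟩ : ∃ n, σ.card = n + 1 := ⟨σ.card - 1, by omega⟩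
  rw [hn, Nat.add_sub_cancel]
  by_cases h2 : (2 : Fin 5) ∈ σ
  · by_cases hs2 : (2 : Fin 5) ∈ σ.erase s
    · have : 0 < n := by
        have := Finset.card_pos.2 ⟨_, hs2⟩
        omega
      have hn3 : n ≤ 3 := by omega
      simp only [h2, hs2, poinD4, weight]
      interval_cases n <;> norm_num <;> ring
    · have hn3 : n ≤ 3 := by omega
      simp only [h2, hs2, poinD4, weight]
      interval_cases n <;> norm_num <;> ring
  · have hs2 : (2 : Fin 5) ∉ σ.erase s := fun h => h2 (Finset.mem_of_mem_erase h)
    simp only [h2, hs2, poinD4, weight, if_false, pow_succ]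

lemma poin_ne_zero (hM : IsAffineD4 Mat) {σ : Finset (Fin 5)} (hσ : σ.card ≤ 4) :
    poin cs σ ≠ 0 := by
  rw [(poin_affineD4 cs hM σ hσ).2]
  intro h
  have := congrArg (Polynomial.eval 1) h
  revert this
  unfold poinD4
  split_ifs <;> simp <;> norm_num

lemma bcoeff_eq (hM : IsAffineD4 Mat) {σ τ : Finset (Fin 5)} (hσ : σ.card ≤ 4) :
    bcoeff cs σ τ =
      (incidence σ τ : R) * weight (LaurentPolynomial.T 1 : R) (2 ∈ σ) (2 ∈ τ) σ.card := by
  unfold bcoeff incidence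
  push_cast
  rw [Finset.sum_mul]
  refine Finset.sum_congr rfl fun s hs => ?_
  split_ifs with h
  · subst h
    rw [poin_eq_poin_erase_mul cs hM hσ hs, mul_div_cancel_left₀ _
      (poin_ne_zero cs hM ((Finset.card_erase_le).trans hσ)), ← Polynomial.toLaurent_X]
    simp only [map_weight]
  · simp

/-- An enumeration of the subsets of cardinality `k ≤ 4` enumerates the `k`-simplices. -/
noncomputable def faceEquiv (hM : IsAffineD4 Mat) {k n : ℕ} (S : Fin n → Finset (Fin 5)) (hk : k ≤ 4)
    (hS : Function.Injective S) (hcard : ∀ i, (S i).card = k)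
    (hsurj : ∀ σ : Finset (Fin 5), σ.card = k → ∃ i, S i = σ) : Fin n ≃ KW cs k :=
  Equiv.ofBijective
    (fun i => ⟨S i, hcard i, (finite_parabolic_iff cs hM _).2 ((hcard i).trans_le hk)⟩)
    ⟨fun _ _ h => hS (congrArg Subtype.val h), fun σ =>
      (hsurj σ.1 σ.2.1).imp fun _ h => Subtype.ext h⟩

lemma bdry_apply (hM : IsAffineD4 Mat) {k n m : ℕ} (hk : k + 1 ≤ 4) (e : Fin n ≃ KW cs k)
    (e' : Fin m ≃ KW cs (k + 1)) (y : KW cs (k + 1) → R) (i : Fin n) :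
    bdry cs k y (e i) = ∑ j, (incidence (e' j).1 (e i).1 : R) *
      weight (LaurentPolynomial.T 1 : R) (2 ∈ (e' j).1) (2 ∈ (e i).1) (k + 1) * y (e' j) := by
  rw [bdry, Matrix.mulVecLin_apply, Matrix.mulVec, dotProduct, ← e'.sum_comp]
  refine Finset.sum_congr rfl fun j _ => ?_
  rw [Matrix.of_apply, bcoeff_eq cs hM ((e' j).2.1.trans_le hk)]
  simp only [(e' j).2.1]

end D4Homology

namespace D4Homology

section ChineseRemainder

variable {A : Type*} [CommRing A] (q h t : A)

lemma sum_idempotents_eq_one (hh : 2 * h = 1) (ht : 3 * t = 1) :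
    h * t * ((1 + q ^ 2) * (1 - q + q ^ 2)) + h * ((1 + q) * (1 + q ^ 3)) +
      t * ((1 - 2 * q) * (1 + q) * (1 + q ^ 2)) = 1 := by
  linear_combination -(h * ((1 + q) * (1 + q ^ 3))) * ht -
    t * ((1 - 2 * q) * (1 + q) * (1 + q ^ 2)) * hh + 3 * t * hh + ht

lemma eq_mul_of_three_factors (hh : 2 * h = 1) (ht : 3 * t = 1) {p : A}
    (ha : ∃ a, p = (1 + q) * a) (hb : ∃ b, p = (1 + q ^ 2) * b)
    (hc : ∃ c, p = (1 - q + q ^ 2) * c) :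
    ∃ d, p = (1 + q ^ 2) * (1 + q ^ 3) * d := by
  obtain ⟨a, ha⟩ := ha
  obtain ⟨b, hb⟩ := hb
  obtain ⟨c, hc⟩ := hc
  refine ⟨h * t * a + h * (1 + q) * b + t * (1 - 2 * q) * c, ?_⟩
  linear_combination (h * t * ((1 + q ^ 2) * (1 - q + q ^ 2))) * ha +
    h * ((1 + q) * (1 + q ^ 3)) * hb + t * ((1 - 2 * q) * (1 + q) * (1 + q ^ 2)) * hc -
    p * sum_idempotents_eq_one q h t hh ht

lemma exists_congr_three_factors (hh : 2 * h = 1) (ht : 3 * t = 1) (a b c : A) :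
    ∃ p, (∃ d, p = a + (1 + q) * d) ∧ (∃ d, p = b + (1 + q ^ 2) * d) ∧
      ∃ d, p = c + (1 - q + q ^ 2) * d := by
  refine ⟨h * t * ((1 + q ^ 2) * (1 - q + q ^ 2)) * a + h * ((1 + q) * (1 + q ^ 3)) * b +
    t * ((1 - 2 * q) * (1 + q) * (1 + q ^ 2)) * c,
    ⟨h * (1 + q ^ 3) * (b - a) + t * (1 - 2 * q) * (1 + q ^ 2) * (c - a), ?_⟩,
    ⟨h * t * (1 - q + q ^ 2) * (a - b) + t * (1 - 2 * q) * (1 + q) * (c - b), ?_⟩,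
    ⟨h * t * (1 + q ^ 2) * (a - c) + h * (1 + q) ^ 2 * (b - c), ?_⟩⟩
  · linear_combination a * sum_idempotents_eq_one q h t hh ht
  · linear_combination b * sum_idempotents_eq_one q h t hh ht
  · linear_combination c * sum_idempotents_eq_one q h t hh ht

end ChineseRemainder

lemma nonempty_homology_equiv {A M N Q : Type*} [CommRing A] [AddCommGroup M] [Module A M]
    [AddCommGroup N] [Module A N] [AddCommGroup Q] [Module A Q] (Z : Submodule A M)
    (f : N →ₗ[A] M) (π : M →ₗ[A] Q) (hf : ∀ y, π (f y) = 0)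
    (hker : ∀ x ∈ Z, π x = 0 → ∃ y, f y = x) (hsurj : ∀ z, ∃ x ∈ Z, π x = z) :
    Nonempty ((Z ⧸ Submodule.comap Z.subtype (LinearMap.range f)) ≃ₗ[A] Q) := by
  have hs : Function.Surjective (π ∘ₗ Z.subtype) := fun z => by
    obtain ⟨x, hx, h⟩ := hsurj z
    exact ⟨⟨x, hx⟩, h⟩
  have hk : Submodule.comap Z.subtype (LinearMap.range f) = LinearMap.ker (π ∘ₗ Z.subtype) := by
    ext ⟨x, hx⟩
    refine ⟨?_, fun h => hker x hx h⟩
    rintro ⟨y, hy⟩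
    have hy : f y = x := hy
    show π x = 0
    rw [← hy, hf]
  exact ⟨(Submodule.quotEquivOfEq _ _ hk).trans (LinearMap.quotKerEquivOfSurjective _ hs)⟩

lemma cyc_two : cyc 2 = 1 + (LaurentPolynomial.T 1 : R) := by
  rw [cyc, cyclotomic_two, ← toLaurent_X]
  simp [add_comm]

lemma cyc_three :
    cyc 3 = 1 + (LaurentPolynomial.T 1 : R) + LaurentPolynomial.T 1 ^ 2 := by
  rw [cyc, cyclotomic_three, ← toLaurent_X]
  simp only [map_add, map_pow, map_one]
  ring

lemma cyc_four : cyc 4 = 1 + (LaurentPolynomial.T 1 : R) ^ 2 := by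
  have : cyclotomic 4 ℚ = 1 + X ^ 2 := by
    rw [show 4 = 2 ^ (1 + 1) by norm_num, cyclotomic_prime_pow_eq_geom_sum Nat.prime_two]
    simp [Finset.sum_range_succ]
  rw [cyc, this, ← toLaurent_X]
  simp only [map_add, map_pow, map_one]

lemma cyc_six :
    cyc 6 = 1 - (LaurentPolynomial.T 1 : R) + LaurentPolynomial.T 1 ^ 2 := by
  rw [cyc, cyclotomic_six, ← toLaurent_X]
  simp only [map_add, map_sub, map_pow, map_one]
  ring

lemma cyc_ne_zero (d : ℕ) : cyc d ≠ 0 := by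
  rw [cyc, Ne, toLaurent_eq_zero]
  exact cyclotomic_ne_zero d ℚ

/-- The quotient map `R → R/(Φ_d)`. -/
noncomputable def mkCyc (d : ℕ) : R →ₗ[R] CycQuot d := Submodule.mkQ (Ideal.span {cyc d})

lemma mkCyc_eq_zero_iff {d : ℕ} {p : R} : mkCyc d p = 0 ↔ ∃ c, p = cyc d * c := by
  rw [mkCyc, Submodule.mkQ_apply, Submodule.Quotient.mk_eq_zero, Ideal.mem_span_singleton]
  rfl

lemma mkCyc_surjective (d : ℕ) : Function.Surjective (mkCyc d) :=
  Submodule.mkQ_surjective _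

lemma mkCyc_eq_of_exists {d : ℕ} {p a : R} (h : ∃ c, p = a + cyc d * c) :
    mkCyc d p = mkCyc d a := by
  obtain ⟨c, rfl⟩ := h
  rw [map_add, mkCyc_eq_zero_iff.2 ⟨c, rfl⟩, add_zero]

lemma exists_two_mul_three_mul :
    ∃ h t : R, 2 * h = 1 ∧ 3 * t = 1 := by
  refine ⟨algebraMap ℚ R (1 / 2), algebraMap ℚ R (1 / 3), ?_, ?_⟩
  · rw [← map_ofNat (algebraMap ℚ R) 2, ← map_mul]
    norm_num
  · rw [← map_ofNat (algebraMap ℚ R) 3, ← map_mul]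
    norm_num

end D4Homology

namespace D4Homology

local notation "𝐪" => (LaurentPolynomial.T 1 : R)

variable {W : Type*} [Group W] {Mat : CoxeterMatrix (Fin 5)} (cs : CoxeterSystem Mat W)

/-- The enumeration of the `0`-simplices by `faces0`. -/
noncomputable def faceEquiv0 (hM : IsAffineD4 Mat) : Fin 1 ≃ KW cs 0 :=
  faceEquiv cs hM faces0 (by norm_num) (by decide +kernel) (by decide +kernel) (by decide +kernel)

/-- The enumeration of the `1`-simplices by `faces1`. -/
noncomputable def faceEquiv1 (hM : IsAffineD4 Mat) : Fin 5 ≃ KW cs 1 :=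
  faceEquiv cs hM faces1 (by norm_num) (by decide +kernel) (by decide +kernel) (by decide +kernel)

/-- The enumeration of the `2`-simplices by `faces2`. -/
noncomputable def faceEquiv2 (hM : IsAffineD4 Mat) : Fin 10 ≃ KW cs 2 :=
  faceEquiv cs hM faces2 (by norm_num) (by decide +kernel) (by decide +kernel) (by decide +kernel)

/-- The enumeration of the `3`-simplices by `faces3`. -/
noncomputable def faceEquiv3 (hM : IsAffineD4 Mat) : Fin 10 ≃ KW cs 3 :=
  faceEquiv cs hM faces3 (by norm_num) (by decide +kernel) (by decide +kernel) (by decide +kernel)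

/-- The enumeration of the `4`-simplices by `faces4`. -/
noncomputable def faceEquiv4 (hM : IsAffineD4 Mat) : Fin 5 ≃ KW cs 4 :=
  faceEquiv cs hM faces4 (by norm_num) (by decide +kernel) (by decide +kernel) (by decide +kernel)

lemma bdry_comp_faceEquiv1 (hM : IsAffineD4 Mat) (y : KW cs 1 → R) :
    bdry cs 0 y ∘ faceEquiv0 cs hM = bd1 𝐪 (y ∘ faceEquiv1 cs hM) := by
  funext i
  rw [← sum_incidence_faces1]
  exact bdry_apply cs hM (by norm_num) (faceEquiv0 cs hM) (faceEquiv1 cs hM) y i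

lemma bdry_comp_faceEquiv2 (hM : IsAffineD4 Mat) (y : KW cs 2 → R) :
    bdry cs 1 y ∘ faceEquiv1 cs hM = bd2 𝐪 (y ∘ faceEquiv2 cs hM) := by
  funext i
  rw [← sum_incidence_faces2]
  exact bdry_apply cs hM (by norm_num) (faceEquiv1 cs hM) (faceEquiv2 cs hM) y i

lemma bdry_comp_faceEquiv3 (hM : IsAffineD4 Mat) (y : KW cs 3 → R) :
    bdry cs 2 y ∘ faceEquiv2 cs hM = bd3 𝐪 (y ∘ faceEquiv3 cs hM) := by
  funext i
  rw [← sum_incidence_faces3]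
  exact bdry_apply cs hM (by norm_num) (faceEquiv2 cs hM) (faceEquiv3 cs hM) y i

lemma bdry_comp_faceEquiv4 (hM : IsAffineD4 Mat) (y : KW cs 4 → R) :
    bdry cs 3 y ∘ faceEquiv3 cs hM = bd4 𝐪 (y ∘ faceEquiv4 cs hM) := by
  funext i
  rw [← sum_incidence_faces4]
  exact bdry_apply cs hM (by norm_num) (faceEquiv3 cs hM) (faceEquiv4 cs hM) y i

lemma mem_cycles_1 (hM : IsAffineD4 Mat) (x : KW cs 1 → R) :
    x ∈ cycles cs 1 ↔ bd1 𝐪 (x ∘ faceEquiv1 cs hM) = 0 := by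
  rw [← bdry_comp_faceEquiv1]
  show bdry cs 0 x = 0 ↔ _
  refine ⟨fun h => by rw [h]; rfl, fun h => ?_⟩
  funext σ
  simpa using congrFun h ((faceEquiv0 cs hM).symm σ)

lemma mem_cycles_2 (hM : IsAffineD4 Mat) (x : KW cs 2 → R) :
    x ∈ cycles cs 2 ↔ bd2 𝐪 (x ∘ faceEquiv2 cs hM) = 0 := by
  rw [← bdry_comp_faceEquiv2]
  show bdry cs 1 x = 0 ↔ _
  refine ⟨fun h => by rw [h]; rfl, fun h => ?_⟩
  funext σ
  simpa using congrFun h ((faceEquiv1 cs hM).symm σ)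

lemma mem_cycles_3 (hM : IsAffineD4 Mat) (x : KW cs 3 → R) :
    x ∈ cycles cs 3 ↔ bd3 𝐪 (x ∘ faceEquiv3 cs hM) = 0 := by
  rw [← bdry_comp_faceEquiv3]
  show bdry cs 2 x = 0 ↔ _
  refine ⟨fun h => by rw [h]; rfl, fun h => ?_⟩
  funext σ
  simpa using congrFun h ((faceEquiv2 cs hM).symm σ)

lemma mem_cycles_4 (hM : IsAffineD4 Mat) (x : KW cs 4 → R) :
    x ∈ cycles cs 4 ↔ bd4 𝐪 (x ∘ faceEquiv4 cs hM) = 0 := by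
  rw [← bdry_comp_faceEquiv4]
  show bdry cs 3 x = 0 ↔ _
  refine ⟨fun h => by rw [h]; rfl, fun h => ?_⟩
  funext σ
  simpa using congrFun h ((faceEquiv3 cs hM).symm σ)

/-- Homology in degree `k` can be computed in the coordinates given by enumerations of simplices. -/
lemma nonempty_hgy_equiv {k n m : ℕ} {Q : Type*} [AddCommGroup Q] [Module R Q]
    (e : Fin n ≃ KW cs k) (e' : Fin m ≃ KW cs (k + 1)) (f : (Fin m → R) → Fin n → R)
    (Z : (Fin n → R) → Prop) (hf : ∀ y, bdry cs k y ∘ e = f (y ∘ e'))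
    (hZ : ∀ x, x ∈ cycles cs k ↔ Z (x ∘ e)) (π : (Fin n → R) →ₗ[R] Q) (hπ : ∀ y, π (f y) = 0)
    (hker : ∀ x, Z x → π x = 0 → ∃ y, f y = x) (hsurj : ∀ z, ∃ x, Z x ∧ π x = z) :
    Nonempty (Hgy cs k ≃ₗ[R] Q) := by
  refine nonempty_homology_equiv (cycles cs k) (bdry cs k) (π ∘ₗ LinearMap.funLeft R R e)
    (fun y => ?_) (fun x hx h => ?_) fun z => ?_
  · exact (congrArg π (hf y)).trans (hπ _)
  · obtain ⟨y, hy⟩ := hker (x ∘ e) ((hZ x).1 hx) h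
    refine ⟨y ∘ e'.symm, funext fun σ => ?_⟩
    have := hf (y ∘ e'.symm)
    rw [Function.comp_assoc, Equiv.symm_comp_self, Function.comp_id, hy] at this
    simpa using congrFun this (e.symm σ)
  · obtain ⟨x, hx, h⟩ := hsurj z
    have hxe : (x ∘ e.symm) ∘ e = x := by
      rw [Function.comp_assoc, Equiv.symm_comp_self, Function.comp_id]
    refine ⟨x ∘ e.symm, (hZ _).2 (hxe.symm ▸ hx), ?_⟩
    exact (congrArg π hxe).trans h

lemma isEmpty_KW (hM : IsAffineD4 Mat) {k : ℕ} (hk : 5 ≤ k) : IsEmpty (KW cs k) :=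
  ⟨fun σ => by
    have := (finite_parabolic_iff cs hM σ.1).1 σ.2.2
    have := σ.2.1
    omega⟩

lemma subsingleton_hgy (hM : IsAffineD4 Mat) {k : ℕ} (hk : 5 ≤ k) : Subsingleton (Hgy cs k) := by
  have := isEmpty_KW cs hM hk
  have : Subsingleton (cycles cs k) := inferInstance
  exact (Submodule.mkQ_surjective _).subsingleton

lemma hgy_zero (hM : IsAffineD4 Mat) : Nonempty (Hgy cs 0 ≃ₗ[R] CycQuot 2) := by
  refine nonempty_hgy_equiv cs (faceEquiv0 cs hM) (faceEquiv1 cs hM) (bd1 𝐪) (fun _ => True)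
    (bdry_comp_faceEquiv1 cs hM) (fun x => by simp [cycles]) (mkCyc 2 ∘ₗ LinearMap.proj 0)
    (fun y => ?_) (fun x _ h => ?_) fun z => ?_
  · exact mkCyc_eq_zero_iff.2 ⟨_, by rw [cyc_two]; rfl⟩
  · obtain ⟨c, hc⟩ := mkCyc_eq_zero_iff.1 h
    refine ⟨![c, 0, 0, 0, 0], ?_⟩
    ext1 i
    fin_cases i
    simpa [bd1, cyc_two] using hc.symm
  · obtain ⟨p, rfl⟩ := mkCyc_surjective 2 z
    exact ⟨fun _ => p, trivial, rfl⟩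

lemma hgy_one (hM : IsAffineD4 Mat) : Nonempty (Hgy cs 1 ≃ₗ[R] CycQuot 3) := by
  refine nonempty_hgy_equiv cs (faceEquiv1 cs hM) (faceEquiv2 cs hM) (bd2 𝐪) (fun x => bd1 𝐪 x = 0)
    (bdry_comp_faceEquiv2 cs hM) (mem_cycles_1 cs hM) (mkCyc 3 ∘ₗ LinearMap.proj 0 ∘ₗ pr1)
    (fun y => ?_) (fun x hx h => ?_) fun z => ?_
  · exact mkCyc_eq_zero_iff.2 (by rw [cyc_three]; exact pr1_bd2 _ y 0)
  · have h := mkCyc_eq_zero_iff.1 h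
    rw [cyc_three] at h
    exact exists_bd2_eq _ (cyc_two ▸ cyc_ne_zero 2) x hx (Fin.forall_fin_one.2 h)
  · obtain ⟨p, rfl⟩ := mkCyc_surjective 3 z
    obtain ⟨x, hx, h⟩ := exists_pr1_eq 𝐪 fun _ => p
    exact ⟨x, hx, congrArg (mkCyc 3) (congrFun h 0)⟩

lemma hgy_two (hM : IsAffineD4 Mat) : Nonempty (Hgy cs 2 ≃ₗ[R] CycQuot 4 × CycQuot 4 × CycQuot 4) := by
  obtain ⟨h, t, hh, ht⟩ := exists_two_mul_three_mul
  let ρ : (Fin 3 → R) →ₗ[R] CycQuot 4 × CycQuot 4 × CycQuot 4 :=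
    (mkCyc 4 ∘ₗ LinearMap.proj 0).prod
      ((mkCyc 4 ∘ₗ LinearMap.proj 1).prod (mkCyc 4 ∘ₗ LinearMap.proj 2))
  have hρ (p : Fin 3 → R) : ρ p = 0 ↔ ∀ i, ∃ c, p i = (1 + 𝐪 ^ 2) * c := by
    rw [← cyc_four]
    simp [ρ, Fin.forall_fin_succ, mkCyc_eq_zero_iff]
  refine nonempty_hgy_equiv cs (faceEquiv2 cs hM) (faceEquiv3 cs hM) (bd3 𝐪) (fun x => bd2 𝐪 x = 0)
    (bdry_comp_faceEquiv3 cs hM) (mem_cycles_2 cs hM) (ρ ∘ₗ pr2 𝐪)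
    (fun y => (hρ _).2 (pr2_bd3 _ y))
    (fun x hx hp => exists_bd3_eq _ h hh (cyc_three ▸ cyc_ne_zero 3) x hx ((hρ _).1 hp)) ?_
  rintro ⟨z₀, z₁, z₂⟩
  obtain ⟨p₀, rfl⟩ := mkCyc_surjective 4 z₀
  obtain ⟨p₁, rfl⟩ := mkCyc_surjective 4 z₁
  obtain ⟨p₂, rfl⟩ := mkCyc_surjective 4 z₂
  obtain ⟨x, hx, h⟩ := exists_pr2_eq 𝐪 ![p₀, p₁, p₂]
  exact ⟨x, hx, congrArg ρ h⟩

lemma hgy_three (hM : IsAffineD4 Mat) :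
    Nonempty (Hgy cs 3 ≃ₗ[R] CycQuot 2 × CycQuot 2 × CycQuot 2 × CycQuot 2 ×
      CycQuot 4 × CycQuot 4 × CycQuot 4 × CycQuot 6 × CycQuot 6 × CycQuot 6) := by
  obtain ⟨h, t, hh, ht⟩ := exists_two_mul_three_mul
  let m (d : ℕ) (i : Fin 4) : (Fin 4 → R) →ₗ[R] CycQuot d := mkCyc d ∘ₗ LinearMap.proj i
  let ρ : (Fin 4 → R) →ₗ[R] CycQuot 2 × CycQuot 2 × CycQuot 2 × CycQuot 2 ×
      CycQuot 4 × CycQuot 4 × CycQuot 4 × CycQuot 6 × CycQuot 6 × CycQuot 6 :=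
    (m 2 0).prod ((m 2 1).prod ((m 2 2).prod ((m 2 3).prod ((m 4 1).prod ((m 4 2).prod
      ((m 4 3).prod ((m 6 1).prod ((m 6 2).prod (m 6 3)))))))))
  have h2 (p : R) : mkCyc 2 p = 0 ↔ ∃ c, p = (1 + 𝐪) * c := by rw [mkCyc_eq_zero_iff, cyc_two]
  have h4 (p : R) : mkCyc 4 p = 0 ↔ ∃ c, p = (1 + 𝐪 ^ 2) * c := by rw [mkCyc_eq_zero_iff, cyc_four]
  have h6 (p : R) : mkCyc 6 p = 0 ↔ ∃ c, p = (1 - 𝐪 + 𝐪 ^ 2) * c := by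
    rw [mkCyc_eq_zero_iff, cyc_six]
  have h246 (p : R) : (∃ c, p = (1 + 𝐪 ^ 2) * (1 + 𝐪 ^ 3) * c) ↔
      mkCyc 2 p = 0 ∧ mkCyc 4 p = 0 ∧ mkCyc 6 p = 0 := by
    rw [h2, h4, h6]
    refine ⟨?_, fun H => eq_mul_of_three_factors 𝐪 h t hh ht H.1 H.2.1 H.2.2⟩
    rintro ⟨c, rfl⟩
    exact ⟨⟨(1 + 𝐪 ^ 2) * (1 - 𝐪 + 𝐪 ^ 2) * c, by ring⟩, ⟨(1 + 𝐪 ^ 3) * c, by ring⟩,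
      ⟨(1 + 𝐪) * (1 + 𝐪 ^ 2) * c, by ring⟩⟩
  have hρ (p : Fin 4 → R) : ρ p = 0 ↔
      ∀ i, ∃ c, p i = (if i = 0 then 1 + 𝐪 else (1 + 𝐪 ^ 2) * (1 + 𝐪 ^ 3)) * c := by
    have e : ρ p = 0 ↔ mkCyc 2 (p 0) = 0 ∧ mkCyc 2 (p 1) = 0 ∧ mkCyc 2 (p 2) = 0 ∧
        mkCyc 2 (p 3) = 0 ∧ mkCyc 4 (p 1) = 0 ∧ mkCyc 4 (p 2) = 0 ∧ mkCyc 4 (p 3) = 0 ∧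
        mkCyc 6 (p 1) = 0 ∧ mkCyc 6 (p 2) = 0 ∧ mkCyc 6 (p 3) = 0 := by
      simp only [Prod.ext_iff]
      rfl
    have e' : (∀ i, ∃ c, p i = (if i = 0 then 1 + 𝐪 else (1 + 𝐪 ^ 2) * (1 + 𝐪 ^ 3)) * c) ↔
        (∃ c, p 0 = (1 + 𝐪) * c) ∧ (∃ c, p 1 = (1 + 𝐪 ^ 2) * (1 + 𝐪 ^ 3) * c) ∧
        (∃ c, p 2 = (1 + 𝐪 ^ 2) * (1 + 𝐪 ^ 3) * c) ∧
        ∃ c, p 3 = (1 + 𝐪 ^ 2) * (1 + 𝐪 ^ 3) * c := by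
      refine ⟨fun H => ⟨H 0, H 1, H 2, H 3⟩, fun H i => ?_⟩
      fin_cases i
      exacts [H.1, H.2.1, H.2.2.1, H.2.2.2]
    rw [e, e', ← h2, h246, h246, h246]
    tauto
  refine nonempty_hgy_equiv cs (faceEquiv3 cs hM) (faceEquiv4 cs hM) (bd4 𝐪) (fun x => bd3 𝐪 x = 0)
    (bdry_comp_faceEquiv4 cs hM) (mem_cycles_3 cs hM) (ρ ∘ₗ pr3 𝐪 h)
    (fun y => (hρ _).2 (pr3_bd4 _ h hh y))
    (fun x hx hp => exists_bd4_eq _ h hh (cyc_two ▸ cyc_ne_zero 2) (cyc_four ▸ cyc_ne_zero 4) x hx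
      ((hρ _).1 hp)) ?_
  have hex (a : CycQuot 2) (b : CycQuot 4) (c : CycQuot 6) :
      ∃ p, mkCyc 2 p = a ∧ mkCyc 4 p = b ∧ mkCyc 6 p = c := by
    obtain ⟨a, rfl⟩ := mkCyc_surjective 2 a
    obtain ⟨b, rfl⟩ := mkCyc_surjective 4 b
    obtain ⟨c, rfl⟩ := mkCyc_surjective 6 c
    obtain ⟨p, ha, hb, hc⟩ := exists_congr_three_factors 𝐪 h t hh ht a b c
    rw [← cyc_two] at ha
    rw [← cyc_four] at hb
    rw [← cyc_six] at hc
    exact ⟨p, mkCyc_eq_of_exists ha, mkCyc_eq_of_exists hb, mkCyc_eq_of_exists hc⟩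
  rintro ⟨a₀, a₁, a₂, a₃, b₁, b₂, b₃, c₁, c₂, c₃⟩
  obtain ⟨p₀, rfl⟩ := mkCyc_surjective 2 a₀
  obtain ⟨p₁, rfl, rfl, rfl⟩ := hex a₁ b₁ c₁
  obtain ⟨p₂, rfl, rfl, rfl⟩ := hex a₂ b₂ c₂
  obtain ⟨p₃, rfl, rfl, rfl⟩ := hex a₃ b₃ c₃
  obtain ⟨x, hx, hp⟩ := exists_pr3_eq 𝐪 h hh ![p₀, p₁, p₂, p₃]
  exact ⟨x, hx, congrArg ρ hp⟩

lemma hgy_four (hM : IsAffineD4 Mat) : Nonempty (Hgy cs 4 ≃ₗ[R] R) := by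
  have := isEmpty_KW cs hM (le_refl 5)
  have e : Fin 0 ≃ KW cs 5 := Equiv.equivOfIsEmpty _ _
  refine nonempty_hgy_equiv cs (faceEquiv4 cs hM) e (fun _ => 0) (fun x => bd4 𝐪 x = 0)
    (fun y => ?_) (mem_cycles_4 cs hM) (LinearMap.proj 0 ∘ₗ pr4) (fun y => map_zero _)
    (fun x hx h => ⟨0, ?_⟩) fun z => ?_
  · have : y = 0 := Subsingleton.elim _ _
    rw [this, map_zero]
    rfl
  · exact (eq_of_bd4 𝐪 (cyc_two ▸ cyc_ne_zero 2) (cyc_four ▸ cyc_ne_zero 4)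
      (cyc_six ▸ cyc_ne_zero 6) x hx (funext (Fin.forall_fin_one.2 h))).symm
  · obtain ⟨x, hx, h⟩ := exists_pr4_eq 𝐪 fun _ => z
    exact ⟨x, hx, congrFun h 0⟩

end D4Homology

/-- Homology of the weighted complex for the affine Coxeter system of type `D̃₄`. -/
theorem homology_affine_D4 {W : Type*} [Group W] {Mat : CoxeterMatrix (Fin 5)}
    (cs : CoxeterSystem Mat W)
    (hM : ∀ i j : Fin 5, i.val < j.val →
      Mat.M i j = (if (i.val, j.val) ∈ ([(0, 2), (1, 2), (2, 3), (2, 4)] : List (ℕ × ℕ)) then 3 else 2)) :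
    Nonempty (Hgy cs 0 ≃ₗ[R] (CycQuot 2)) ∧
    Nonempty (Hgy cs 1 ≃ₗ[R] (CycQuot 3)) ∧
    Nonempty (Hgy cs 2 ≃ₗ[R] (CycQuot 4 × CycQuot 4 × CycQuot 4)) ∧
    Nonempty (Hgy cs 3 ≃ₗ[R] (CycQuot 2 × CycQuot 2 × CycQuot 2 × CycQuot 2 × CycQuot 4 × CycQuot 4 × CycQuot 4 × CycQuot 6 × CycQuot 6 × CycQuot 6)) ∧
    Nonempty (Hgy cs 4 ≃ₗ[R] R) ∧
    (∀ k, 5 ≤ k → Subsingleton (Hgy cs k)) := by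
  have h := isAffineD4_of_lt hM
  exact ⟨D4Homology.hgy_zero cs h, D4Homology.hgy_one cs h, D4Homology.hgy_two cs h,
    D4Homology.hgy_three cs h, D4Homology.hgy_four cs h,
    fun _ hk => D4Homology.subsingleton_hgy cs h hk⟩
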